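/- Let f₀ : S² ↪ ℝ³ be the standard embedding and p ∈ S². The space Imm_p(S², ℝ³) of pointed immersions of S² into ℝ³ is path-connected: π₀(Imm_p(S², ℝ³)) = 0. -/

import Mathlib

open Metric Function
open scoped Manifold

noncomputable section

abbrev E3 := EuclideanSpace ℝ (Fin 3)
abbrev S2 := Metric.sphere (0 : E3) 1

instance : Fact (Module.finrank ℝ E3 = 2 + 1) := ⟨by simp⟩

/-- The standard embedding of `S²` in `ℝ³`. -/
def stdEmb : S2 → E3 := fun x => (x : E3)

/-- A `C¹` immersion of the sphere `S²` into `ℝ³`. -/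
def IsImmersionS2 (f : S2 → E3) : Prop :=
  ContMDiff (𝓡 2) 𝓘(ℝ, E3) 1 f ∧
    ∀ x : S2, Injective (mfderiv (𝓡 2) 𝓘(ℝ, E3) f x)

/-- The space `Imm_p(S², ℝ³)` of immersions `f : S² → ℝ³` with `f p = f₀ p` and
`df(p) = df₀(p)`, where `f₀` is the standard embedding. -/
def PointedImm (p : S2) : Type :=
  {f : S2 → E3 // IsImmersionS2 f ∧ f p = stdEmb p ∧
    mfderiv (𝓡 2) 𝓘(ℝ, E3) f p = mfderiv (𝓡 2) 𝓘(ℝ, E3) stdEmb p}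

/-- The `C¹` topology on `Imm_p(S², ℝ³)`: the topology induced by the map
`f ↦ Tf` into the space of continuous maps between the tangent bundles (which records
both `f` and `df`), with the compact-open topology. -/
instance (p : S2) : TopologicalSpace (PointedImm p) :=
  TopologicalSpace.induced
    (fun f : PointedImm p =>
      (⟨tangentMap (𝓡 2) 𝓘(ℝ, E3) f.1, f.2.1.1.continuous_tangentMap le_rfl⟩ :
        C(TangentBundle (𝓡 2) S2, TangentBundle 𝓘(ℝ, E3) E3)))
    inferInstance

section Auxiliary

open scoped Matrix Topology ContDiff Quaternion

/-- The normal component of a loop of vectors around the line spanned by `v`, based at `u` and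
with average `w`. -/
def loopNormal (u v w : Fin 3 → ℝ) : Fin 3 → ℝ :=
  (8 * (((w - u) ⬝ᵥ (v ⨯₃ (u ⨯₃ v)) / ((u ⨯₃ v) ⬝ᵥ (u ⨯₃ v))) ^ 2 +
    ((w - u) ⬝ᵥ (u ⨯₃ v) / ((u ⨯₃ v) ⬝ᵥ (u ⨯₃ v))) ^ 2)) • (u ⨯₃ v)

lemma loopNormal_self (u v : Fin 3 → ℝ) : loopNormal u v u = 0 := by
  simp [loopNormal]

lemma loop_cross_ne_zero {u v : Fin 3 → ℝ} (h : u ⨯₃ v ≠ 0) (w : Fin 3 → ℝ) {σ : ℝ}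
    (hσ : |σ| ≤ 1) : (u + (2 * σ ^ 2) • (w - u) + σ • loopNormal u v w) ⨯₃ v ≠ 0 := by
  intro h0
  set n := u ⨯₃ v with hn
  set d := n ⬝ᵥ n with hd
  have hd0 : d ≠ 0 := by simpa [hd] using h
  set α := (w - u) ⬝ᵥ (v ⨯₃ n) / d with hα
  set β := (w - u) ⬝ᵥ n / d with hβ
  set γ := u + (2 * σ ^ 2) • (w - u) + σ • loopNormal u v w with hγ
  have hγ' : γ = u + (2 * σ ^ 2) • (w - u) + (σ * (8 * (α ^ 2 + β ^ 2))) • n := by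
    rw [hγ, loopNormal, smul_smul]
  have h1 : γ ⬝ᵥ n = 0 := by
    rw [hn, triple_product_permutation, ← cross_anticomm, h0]; simp
  have h2 : γ ⬝ᵥ (v ⨯₃ n) = 0 := by
    rw [triple_product_permutation, triple_product_permutation, h0]; simp
  have h3 : u ⬝ᵥ (v ⨯₃ n) = d := by
    rw [triple_product_permutation, triple_product_permutation, hd]
  have h4 : u ⬝ᵥ n = 0 := dot_self_cross u v
  have h5 : n ⬝ᵥ (v ⨯₃ n) = 0 := dot_cross_self v n
  have e1 : (w - u) ⬝ᵥ n = β * d := by rw [hβ]; field_simp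
  have e2 : (w - u) ⬝ᵥ (v ⨯₃ n) = α * d := by rw [hα]; field_simp
  rw [hγ', add_dotProduct, add_dotProduct, smul_dotProduct, smul_dotProduct, smul_eq_mul,
    smul_eq_mul] at h1 h2
  rw [h4, e1, ← hd] at h1
  rw [h3, e2, h5] at h2
  have h1' : σ * (2 * σ * β + 8 * (α ^ 2 + β ^ 2)) = 0 := by
    apply mul_right_cancel₀ hd0; linear_combination h1
  have h2' : 1 + 2 * σ ^ 2 * α = 0 := by
    apply mul_right_cancel₀ hd0; linear_combination h2
  have hs : σ ≠ 0 := by rintro rfl; norm_num at h2'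
  have h1'' := (mul_eq_zero.1 h1').resolve_left hs
  have hσ2 : σ ^ 2 ≤ 1 := by rw [← sq_abs]; nlinarith [abs_nonneg σ]
  have hα' : α ≤ -1 / 2 := by
    by_contra! hα'
    have := mul_pos (pow_pos (abs_pos.2 hs) 2) (sub_pos.2 hα')
    rw [sq_abs] at this
    linarith
  nlinarith [sq_nonneg (σ + 8 * β), sq_nonneg (σ + β)]

lemma isOpen_cross_ne_zero : IsOpen {q : (Fin 3 → ℝ) × (Fin 3 → ℝ) | q.1 ⨯₃ q.2 ≠ 0} := by
  refine isOpen_ne_fun ?_ continuous_const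
  simp only [cross_apply]
  fun_prop

@[fun_prop]
lemma Continuous.crossProd {X : Type*} [TopologicalSpace X] {u v : X → Fin 3 → ℝ}
    (hu : Continuous u) (hv : Continuous v) : Continuous fun x => u x ⨯₃ v x := by
  simp only [cross_apply]
  fun_prop

lemma Continuous.loopNormal {X : Type*} [TopologicalSpace X] {u v w : X → Fin 3 → ℝ}
    (hu : Continuous u) (hv : Continuous v) (hw : Continuous w) (h : ∀ x, u x ⨯₃ v x ≠ 0) :
    Continuous fun x => loopNormal (u x) (v x) (w x) := by
  have hd : ∀ x, (u x ⨯₃ v x) ⬝ᵥ (u x ⨯₃ v x) ≠ 0 := fun x => by simpa using h x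
  unfold _root_.loopNormal
  have hn : Continuous fun x => u x ⨯₃ v x := hu.crossProd hv
  have hm : Continuous fun x => v x ⨯₃ (u x ⨯₃ v x) := hv.crossProd hn
  have hwu := hw.sub hu
  have hdd := hn.dotProduct hn
  exact (continuous_const.mul ((((hwu.dotProduct hm).div hdd hd).pow 2).add
    (((hwu.dotProduct hn).div hdd hd).pow 2))).smul hn

section Corrugation

variable {W : Type*} [NormedAddCommGroup W] [NormedSpace ℝ W]

/-- The corrugation of `F` in direction `ℓ` with frequency `N` and amplitudes `a`, `b`. -/
def corrugation (F a b : W → Fin 3 → ℝ) (ℓ : W →L[ℝ] ℝ) (N : ℝ) (z : W) : Fin 3 → ℝ :=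
  F z - (N⁻¹ * (Real.sin (2 * (N * ℓ z)) / 2)) • a z - (N⁻¹ * Real.cos (N * ℓ z)) • b z

variable {F a b : W → Fin 3 → ℝ} {ℓ : W →L[ℝ] ℝ} {N : ℝ}

lemma contDiff_corrugation (hF : ContDiff ℝ 1 F) (ha : ContDiff ℝ 1 a) (hb : ContDiff ℝ 1 b) :
    ContDiff ℝ 1 (corrugation F a b ℓ N) := by
  unfold corrugation
  fun_prop

lemma fderiv_corrugation (hF : ContDiff ℝ 1 F) (ha : ContDiff ℝ 1 a) (hb : ContDiff ℝ 1 b)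
    (hN : N ≠ 0) (z h : W) :
    fderiv ℝ (corrugation F a b ℓ N) z h = fderiv ℝ F z h
      - (ℓ h * Real.cos (2 * (N * ℓ z))) • a z + (ℓ h * Real.sin (N * ℓ z)) • b z
      - N⁻¹ • ((Real.sin (2 * (N * ℓ z)) / 2) • fderiv ℝ a z h
        + Real.cos (N * ℓ z) • fderiv ℝ b z h) := by
  have hF' := (hF.differentiable one_ne_zero z).hasFDerivAt
  have ha' := (ha.differentiable one_ne_zero z).hasFDerivAt
  have hb' := (hb.differentiable one_ne_zero z).hasFDerivAt
  have hθ : HasFDerivAt (fun z => N * ℓ z) (N • ℓ) z := ℓ.hasFDerivAt.const_mul N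
  have h1 := ((((hθ.const_mul 2).sin).mul_const (1/2)).const_mul N⁻¹).smul ha'
  have h2 := ((hθ.cos).const_mul N⁻¹).smul hb'
  have h3 := (hF'.sub h1).sub h2
  have h4 : corrugation F a b ℓ N =
      F - (fun z => N⁻¹ * (Real.sin (2 * (N * ℓ z)) * (1/2))) • a -
        (fun z => N⁻¹ * Real.cos (N * ℓ z)) • b := by
    ext1 z; simp [corrugation, div_eq_mul_inv]
  rw [h4, HasFDerivAt.fderiv h3]
  ext i
  simp
  field_simp
  ring

/-- One step of convex integration: making `F` solve, in the direction `e`, the differential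
relation of being independent of `v`. -/
lemma exists_corrugation [FiniteDimensional ℝ W] (hF : ContDiff ℝ 1 F) {u v : W → Fin 3 → ℝ}
    (hu : Continuous u) (hv : Continuous v) (huv : ∀ z, u z ⨯₃ v z ≠ 0) {e e' : W} (he : ℓ e = 1)
    (he' : ℓ e' = 0) {K : Set W} (hK : IsCompact K) (hFK : ∀ z ∉ K, fderiv ℝ F z e = u z) :
    ∃ G : W → Fin 3 → ℝ, ContDiff ℝ 1 G ∧ (∀ z ∉ K, G z = F z) ∧
      (∀ z, fderiv ℝ G z e ⨯₃ v z ≠ 0) ∧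
      ∀ z, fderiv ℝ G z e ⨯₃ (v z + (fderiv ℝ G z e' - fderiv ℝ F z e')) ≠ 0 := by
  have hw : Continuous fun z => fderiv ℝ F z e :=
    (hF.continuous_fderiv one_ne_zero).clm_apply continuous_const
  set w : W → Fin 3 → ℝ := fun z => fderiv ℝ F z e with hwdef
  have hn := Continuous.loopNormal hu hv hw huv
  let γ : W × ℝ → (Fin 3 → ℝ) × (Fin 3 → ℝ) := fun q =>
    (u q.1 + (2 * q.2 ^ 2) • (w q.1 - u q.1) + q.2 • loopNormal (u q.1) (v q.1) (w q.1), v q.1)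
  have hγ : Continuous γ := by
    have := hn.comp (continuous_fst (X := W) (Y := ℝ))
    simp only [comp_def] at this
    fun_prop
  obtain ⟨δ, hδ, hδO⟩ := ((hK.prod (isCompact_Icc (a := (-1 : ℝ)) (b := 1))).image
    hγ).exists_thickening_subset_open isOpen_cross_ne_zero (by
      rintro _ ⟨⟨z, s⟩, ⟨-, hs⟩, rfl⟩
      exact loop_cross_ne_zero (huv z) _ (abs_le.2 hs))
  obtain ⟨a, ha, haδ, haS⟩ := (hw.sub hu).exists_contDiff_approx 1 (continuous_const (y := δ / 4))
    (fun _ => by positivity)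
  obtain ⟨b, hb, hbδ, hbS⟩ := hn.exists_contDiff_approx 1 (continuous_const (y := δ / 4))
    (fun _ => by positivity)
  have ha : ContDiff ℝ 1 a := ha
  have hb : ContDiff ℝ 1 b := hb
  have haK : ∀ z ∉ K, a z = 0 := fun z hz => by
    by_contra h
    exact haS h (by simp [hwdef, hFK z hz])
  have hbK : ∀ z ∉ K, b z = 0 := fun z hz => by
    by_contra h
    exact hbS h (by simp [hwdef, hFK z hz, loopNormal_self])
  obtain ⟨A, hA⟩ := hK.exists_bound_of_continuousOn
    (ha.continuous_fderiv one_ne_zero).continuousOn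
  obtain ⟨B, hB⟩ := hK.exists_bound_of_continuousOn
    (hb.continuous_fderiv one_ne_zero).continuousOn
  obtain ⟨N, hN⟩ := exists_gt (max 0 ((|A| + |B|) * (‖e‖ + ‖e'‖) / (δ / 4)))
  have hN0 : 0 < N := (le_max_left _ _).trans_lt hN
  have hNb : (|A| + |B|) * (‖e‖ + ‖e'‖) / N < δ / 4 := by
    have := (le_max_right _ _).trans_lt hN
    rw [div_lt_iff₀ (by positivity)] at this
    rw [div_lt_iff₀ hN0]; linarith
  set G := corrugation F a b ℓ N with hG
  have hGF : ∀ z ∉ K, G z = F z := fun z hz => by simp [hG, corrugation, haK z hz, hbK z hz]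
  have herr : ∀ z ∈ K, ∀ h, ‖h‖ ≤ ‖e‖ + ‖e'‖ →
      ‖N⁻¹ • ((Real.sin (2 * (N * ℓ z)) / 2) • fderiv ℝ a z h
        + Real.cos (N * ℓ z) • fderiv ℝ b z h)‖ < δ / 4 := by
    intro z hz h hh
    refine lt_of_le_of_lt ?_ hNb
    rw [norm_smul, norm_inv, Real.norm_of_nonneg hN0.le, inv_mul_eq_div]
    gcongr
    have h1 : ‖fderiv ℝ a z h‖ ≤ |A| * (‖e‖ + ‖e'‖) :=
      ((fderiv ℝ a z).le_opNorm h).trans (by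
        gcongr; exact (hA z hz).trans (le_abs_self A))
    have h2 : ‖fderiv ℝ b z h‖ ≤ |B| * (‖e‖ + ‖e'‖) :=
      ((fderiv ℝ b z).le_opNorm h).trans (by
        gcongr; exact (hB z hz).trans (le_abs_self B))
    have h3 : ‖Real.sin (2 * (N * ℓ z)) / 2‖ ≤ 1 := by
      rw [Real.norm_eq_abs, abs_div, abs_two]
      linarith [Real.abs_sin_le_one (2 * (N * ℓ z))]
    have h4 : ‖Real.cos (N * ℓ z)‖ ≤ 1 := Real.abs_cos_le_one _
    calc _ ≤ _ := norm_add_le _ _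
      _ ≤ 1 * (|A| * (‖e‖ + ‖e'‖)) + 1 * (|B| * (‖e‖ + ‖e'‖)) := by
        rw [norm_smul, norm_smul]; gcongr
      _ = _ := by ring
  have hKop := hK.isClosed.isOpen_compl
  have hfd : ∀ z ∉ K, fderiv ℝ G z = fderiv ℝ F z := fun z hz =>
    Filter.EventuallyEq.fderiv_eq (Filter.eventuallyEq_of_mem (hKop.mem_nhds hz) hGF)
  have hclose : ∀ z ∈ K, ‖fderiv ℝ G z e - (γ (z, Real.sin (N * ℓ z))).1‖ < δ := by
    intro z hz
    have key : fderiv ℝ G z e - (γ (z, Real.sin (N * ℓ z))).1 =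
        (-Real.cos (2 * (N * ℓ z))) • (a z - (w z - u z))
        + Real.sin (N * ℓ z) • (b z - loopNormal (u z) (v z) (w z))
        - N⁻¹ • ((Real.sin (2 * (N * ℓ z)) / 2) • fderiv ℝ a z e
        + Real.cos (N * ℓ z) • fderiv ℝ b z e) := by
      rw [hG, fderiv_corrugation hF ha hb hN0.ne']
      have : 2 * Real.sin (N * ℓ z) ^ 2 = 1 - Real.cos (2 * (N * ℓ z)) := by
        rw [Real.cos_two_mul, Real.sin_sq]; ring
      simp only [γ, this, he, hwdef]
      module
    rw [key]
    have err := herr z hz e (by linarith [norm_nonneg e'])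
    have e2 : ‖(-Real.cos (2 * (N * ℓ z))) • (a z - (w z - u z))‖ ≤ δ / 4 := by
      rw [norm_smul, norm_neg]
      have h1 : ‖a z - (w z - u z)‖ ≤ δ / 4 := by rw [← dist_eq_norm]; exact (haδ z).le
      have h2 := Real.abs_cos_le_one (2 * (N * ℓ z))
      calc _ ≤ 1 * (δ/4) := by gcongr; exact h2
        _ = _ := one_mul _
    have e3 : ‖Real.sin (N * ℓ z) • (b z - loopNormal (u z) (v z) (w z))‖ ≤ δ / 4 := by
      rw [norm_smul]
      have h1 := (hbδ z).le
      rw [dist_eq_norm] at h1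
      have h2 := Real.abs_sin_le_one (N * ℓ z)
      calc _ ≤ 1 * (δ/4) := by gcongr; exact h2
        _ = _ := one_mul _
    calc _ ≤ _ := norm_sub_le _ _
      _ ≤ _ := add_le_add_left (norm_add_le _ _) _
      _ < δ := by linarith
  have hclose' : ∀ z ∈ K, ‖fderiv ℝ G z e' - fderiv ℝ F z e'‖ < δ := by
    intro z hz
    rw [hG, fderiv_corrugation hF ha hb hN0.ne', he']
    have := herr z hz e' (by linarith [norm_nonneg e])
    rw [zero_mul, zero_mul, zero_smul, zero_smul, sub_zero, add_zero, sub_sub_cancel_left, norm_neg]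
    linarith
  have hmem : ∀ z ∈ K, ∀ x, ‖x‖ < δ → fderiv ℝ G z e ⨯₃ (v z + x) ≠ 0 := by
    intro z hz x hx
    refine @hδO (fderiv ℝ G z e, v z + x) (mem_thickening_iff.2
      ⟨_, ⟨(z, Real.sin (N * ℓ z)), ⟨hz, abs_le.1 (Real.abs_sin_le_one _)⟩, rfl⟩, ?_⟩)
    rw [Prod.dist_eq, dist_eq_norm, dist_eq_norm]
    refine max_lt (hclose z hz) ?_
    simpa [γ] using hx
  refine ⟨G, contDiff_corrugation hF ha hb, hGF, fun z => ?_, fun z => ?_⟩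
  · by_cases hz : z ∈ K
    · simpa using hmem z hz 0 (by simpa using hδ)
    · rw [hfd z hz, hFK z hz]; exact huv z
  · by_cases hz : z ∈ K
    · exact hmem z hz _ (hclose' z hz)
    · rw [hfd z hz, hFK z hz]; simpa using huv z

end Corrugation

/-- The space of pairs of linearly independent vectors of `ℝ³`. -/
abbrev Frame := {q : (Fin 3 → ℝ) × (Fin 3 → ℝ) // q.1 ⨯₃ q.2 ≠ 0}

/-- Immersions of the plane into `ℝ³`, of class `C¹`. -/
structure PlaneImmersion (g : ℝ × ℝ → Fin 3 → ℝ) : Prop where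
  contDiff : ContDiff ℝ 1 g
  cross_ne_zero : ∀ x, fderiv ℝ g x (1, 0) ⨯₃ fderiv ℝ g x (0, 1) ≠ 0

/-- The frame field of partial derivatives of an immersion of the plane. -/
def PlaneImmersion.frame {g : ℝ × ℝ → Fin 3 → ℝ} (hg : PlaneImmersion g) : C(ℝ × ℝ, Frame) where
  toFun x := ⟨(fderiv ℝ g x (1, 0), fderiv ℝ g x (0, 1)), hg.cross_ne_zero x⟩
  continuous_toFun := by
    have := hg.contDiff.continuous_fderiv one_ne_zero
    exact ((this.clm_apply continuous_const).prodMk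
      (this.clm_apply continuous_const)).subtype_mk _

lemma fderiv_slice {G : ℝ × ℝ × ℝ → Fin 3 → ℝ} (hG : ContDiff ℝ 1 G) (t : ℝ) (x h : ℝ × ℝ) :
    fderiv ℝ (fun x => G (t, x)) x h = fderiv ℝ G (t, x) (0, h) := by
  have h1 := (hG.differentiable one_ne_zero (t, x)).hasFDerivAt
  have h2 := h1.comp x (hasFDerivAt_prodMk_right (𝕜 := ℝ) t x)
  have h3 : (fun x => G (t, x)) = G ∘ fun x => (t, x) := rfl
  rw [h3, h2.fderiv]
  simp

/-- The `h`-principle for homotopies of immersions of the plane with compact support. -/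
theorem exists_regularHomotopy_of_homotopicRel {g₀ g₁ : ℝ × ℝ → Fin 3 → ℝ}
    (h₀ : PlaneImmersion g₀) (h₁ : PlaneImmersion g₁) {K : Set (ℝ × ℝ)} (hK : IsCompact K)
    (hgK : ∀ x ∉ K, g₀ x = g₁ x) (H : h₀.frame.HomotopicRel h₁.frame Kᶜ) :
    ∃ G : ℝ × ℝ × ℝ → Fin 3 → ℝ, ContDiff ℝ 1 G ∧ (∀ x, G (-1, x) = g₀ x) ∧
      (∀ x, G (2, x) = g₁ x) ∧ (∀ t, ∀ x ∉ K, G (t, x) = g₀ x) ∧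
      ∀ t, PlaneImmersion fun x => G (t, x) := by
  obtain ⟨H⟩ := H
  have hc₀ := h₀.contDiff
  have hc₁ := h₁.contDiff
  let F : ℝ × ℝ × ℝ → Fin 3 → ℝ := fun z => g₀ z.2 + Real.smoothTransition z.1 • (g₁ z.2 - g₀ z.2)
  have hF : ContDiff ℝ 1 F := by
    have : ContDiff ℝ 1 fun z : ℝ × ℝ × ℝ => Real.smoothTransition z.1 :=
      Real.smoothTransition.contDiff.comp contDiff_fst
    fun_prop
  have hFd : ∀ t x h, fderiv ℝ F (t, x) (0, h) =
      fderiv ℝ g₀ x h + Real.smoothTransition t • (fderiv ℝ g₁ x h - fderiv ℝ g₀ x h) := by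
    intro t x h
    rw [← fderiv_slice hF]
    have e₀ := (hc₀.differentiable one_ne_zero x).hasFDerivAt
    have e₁ := (hc₁.differentiable one_ne_zero x).hasFDerivAt
    have := e₀.add ((e₁.sub e₀).const_smul (Real.smoothTransition t))
    have e : (fun x => F (t, x)) = g₀ + Real.smoothTransition t • (g₁ - g₀) := rfl
    rw [e, this.fderiv]
    simp
  have hdK : ∀ x ∉ K, fderiv ℝ g₀ x = fderiv ℝ g₁ x := fun x hx =>
    Filter.EventuallyEq.fderiv_eq
      (Filter.eventuallyEq_of_mem (hK.isClosed.isOpen_compl.mem_nhds hx) hgK)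
  let U : ℝ × ℝ × ℝ → Frame := fun z => H.extend z.1 z.2
  have hU : Continuous U := by
    have := H.extend.continuous
    fun_prop
  let u : ℝ × ℝ × ℝ → Fin 3 → ℝ := fun z => (U z).1.1
  let v : ℝ × ℝ × ℝ → Fin 3 → ℝ := fun z => (U z).1.2
  have hu : Continuous u := by fun_prop
  have hv : Continuous v := by fun_prop
  have huv : ∀ z, u z ⨯₃ v z ≠ 0 := fun z => (U z).2
  set L := Set.Icc (0 : ℝ) 1 ×ˢ K with hL
  have hLc : IsCompact L := isCompact_Icc.prod hK
  have hUL : ∀ z ∉ L, (U z).1 = (fderiv ℝ F z (0, 1, 0), fderiv ℝ F z (0, 0, 1)) := by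
    rintro ⟨t, x⟩ hz
    rw [hFd, hFd]
    by_cases hx : x ∈ K
    · have ht : t < 0 ∨ 1 < t := by
        by_contra! ht
        exact hz ⟨ht, hx⟩
      obtain ht | ht := ht
      · have : U (t, x) = h₀.frame x := by
          simp only [U]; rw [ContinuousMap.Homotopy.extend_apply_of_le_zero _ ht.le]
        rw [this, Real.smoothTransition.zero_of_nonpos ht.le]
        simp [PlaneImmersion.frame]
      · have : U (t, x) = h₁.frame x := by
          simp only [U]; rw [ContinuousMap.Homotopy.extend_apply_of_one_le _ ht.le]
        rw [this, Real.smoothTransition.one_of_one_le ht.le]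
        simp [PlaneImmersion.frame]
    · have : U (t, x) = h₀.frame x := H.eq_fst _ hx
      rw [this, hdK x hx]
      simp [PlaneImmersion.frame, hdK x hx]
  obtain ⟨G, hG, hGL, hGv, -⟩ := exists_corrugation (ℓ := (ContinuousLinearMap.fst ℝ ℝ ℝ).comp
    (ContinuousLinearMap.snd ℝ ℝ (ℝ × ℝ))) hF hu hv huv (e := (0, 1, 0)) (e' := (0, 0, 1))
    (by simp) (by simp) hLc (fun z hz => by simp only [u, hUL z hz])
  have hGd : ∀ z ∉ L, fderiv ℝ G z = fderiv ℝ F z := fun z hz =>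
    Filter.EventuallyEq.fderiv_eq
      (Filter.eventuallyEq_of_mem (hLc.isClosed.isOpen_compl.mem_nhds hz) hGL)
  have hux : Continuous fun z => fderiv ℝ G z (0, 1, 0) :=
    (hG.continuous_fderiv one_ne_zero).clm_apply continuous_const
  obtain ⟨P, hP, hPL, -, hPv⟩ := exists_corrugation (ℓ := (ContinuousLinearMap.snd ℝ ℝ ℝ).comp
    (ContinuousLinearMap.snd ℝ ℝ (ℝ × ℝ))) hG hv hux
    (fun z h => hGv z (by rw [← cross_anticomm, h, neg_zero]))
    (e := (0, 0, 1)) (e' := (0, 1, 0))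
    (by simp) (by simp) hLc (fun z hz => by simp only [v, hUL z hz, hGd z hz])
  have hPF : ∀ z ∉ L, P z = F z := fun z hz => (hPL z hz).trans (hGL z hz)
  refine ⟨P, hP, fun x => ?_, fun x => ?_, fun t x hx => ?_, fun t => ⟨by fun_prop, fun x => ?_⟩⟩
  · rw [hPF _ (fun h => by have := h.1.1; norm_num at this)]
    simp [F, Real.smoothTransition.zero_of_nonpos (show (-1 : ℝ) ≤ 0 by norm_num)]
  · rw [hPF _ (fun h => by have := h.1.2; norm_num at this)]
    simp [F, Real.smoothTransition.one_of_one_le (show (1 : ℝ) ≤ 2 by norm_num)]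
  · rw [hPF _ (fun h => hx h.2)]
    simp [F, hgK x hx]
  · rw [fderiv_slice hP, fderiv_slice hP]
    intro h
    have := hPv (t, x)
    rw [add_sub_cancel, ← cross_anticomm, h, neg_zero] at this
    exact this rfl

section Intertwiner

variable {A : Type*} [Ring A]

/-- The average over the quaternion group of the product of one of the two representations given
by the pairs of generators with the inverse of the other one: it intertwines them. -/
def intertwiner (a b a' b' : A) : A := 1 - a * a' - b * b' - a * b * (a' * b')

variable {a b a' b' : A}

lemma intertwiner_mul_left (ha : a * a = -1) (ha' : a' * a' = -1)
    (hab' : a' * b' = -(b' * a')) :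
    intertwiner a b a' b' * a' = a * intertwiner a b a' b' := by
  have e1 : a * a' * a' = -a := by rw [mul_assoc, ha', mul_neg_one]
  have e2 : b * b' * a' = -(b * (a' * b')) := by rw [hab', mul_neg, neg_neg, mul_assoc]
  have e3 : a * b * (a' * b') * a' = a * b * b' := by
    rw [hab', mul_neg, neg_mul, mul_assoc, mul_assoc b', ha', mul_neg_one, mul_neg, neg_neg]
  have e4 : a * (a * a') = -a' := by rw [← mul_assoc, ha, neg_one_mul]
  have e5 : a * (b * b') = a * b * b' := by rw [mul_assoc]
  have e6 : a * (a * b * (a' * b')) = -(b * (a' * b')) := by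
    rw [mul_assoc a b, ← mul_assoc a a, ha, neg_one_mul]
  simp only [intertwiner, sub_mul, mul_sub, one_mul, mul_one, e1, e2, e3, e4, e5, e6]
  abel

lemma intertwiner_mul_right (hb : b * b = -1) (hab : a * b = -(b * a)) (hb' : b' * b' = -1) :
    intertwiner a b a' b' * b' = b * intertwiner a b a' b' := by
  have e1 : a * a' * b' = a * (a' * b') := mul_assoc _ _ _
  have e2 : b * b' * b' = -b := by rw [mul_assoc, hb', mul_neg_one]
  have e3 : a * b * (a' * b') * b' = -(a * b * a') := by
    rw [mul_assoc, mul_assoc a', hb', mul_neg_one, mul_neg]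
  have e4 : b * (b * b') = -b' := by rw [← mul_assoc, hb, neg_one_mul]
  have e5 : b * (a * a') = -(a * b * a') := by rw [hab, neg_mul, neg_neg, mul_assoc]
  have e6 : b * (a * b * (a' * b')) = a * (a' * b') := by
    rw [hab, neg_mul, mul_neg, mul_assoc b a, ← mul_assoc b b, hb, neg_one_mul, neg_neg]
  simp only [intertwiner, sub_mul, mul_sub, one_mul, mul_one, e1, e2, e3, e4, e5, e6]
  abel

end Intertwiner

/-- A pair of anticommuting square roots of `-1`. -/
structure IsQuaternionPair (a b : ℍ) : Prop where
  left : a * a = -1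
  right : b * b = -1
  anti : a * b = -(b * a)

lemma norm_eq_one_of_mul_self {a : ℍ} (h : a * a = -1) : ‖a‖ = 1 := by
  have := congrArg norm h
  rw [norm_mul, norm_neg, norm_one] at this
  nlinarith [norm_nonneg a]

lemma intertwiner_self {a b : ℍ} (h : IsQuaternionPair a b) : intertwiner a b a b = 4 := by
  have e : a * b * (a * b) = -1 := by
    nth_rewrite 2 [h.anti]
    rw [mul_neg, mul_assoc, ← mul_assoc b b, h.right, neg_one_mul, mul_neg, neg_neg, h.left]
  rw [intertwiner, h.left, h.right, e]
  norm_num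

lemma intertwiner_ne_zero {a b a' b' : ℍ} (h : IsQuaternionPair a b)
    (ha : ‖a' - a‖ < 1) (hb : ‖b' - b‖ < 1) (h' : IsQuaternionPair a' b') :
    intertwiner a b a' b' ≠ 0 := by
  intro h0
  have na := norm_eq_one_of_mul_self h.left
  have nb := norm_eq_one_of_mul_self h.right
  have nb' := norm_eq_one_of_mul_self h'.right
  have key : (4 : ℍ) = a * (a' - a) + b * (b' - b) + (a * b) * ((a' - a) * b' + a * (b' - b)) := by
    have h1 := intertwiner_self h
    rw [← sub_zero (4 : ℍ), ← h0, ← h1]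
    simp only [intertwiner]
    noncomm_ring
  have h4 : ‖(4 : ℍ)‖ = 4 := by
    have : (4 : ℍ) = ((4 : ℝ) : ℍ) := by norm_cast
    rw [this, Quaternion.norm_coe]; norm_num
  have := congrArg norm key
  rw [h4] at this
  have n1 : ‖a * (a' - a)‖ = ‖a' - a‖ := by rw [norm_mul, na, one_mul]
  have n2 : ‖b * (b' - b)‖ = ‖b' - b‖ := by rw [norm_mul, nb, one_mul]
  have n3 : ‖(a * b) * ((a' - a) * b' + a * (b' - b))‖ ≤ ‖a' - a‖ + ‖b' - b‖ := by
    rw [norm_mul, norm_mul, na, nb, one_mul, one_mul]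
    refine (norm_add_le _ _).trans ?_
    rw [norm_mul, norm_mul, nb', na, one_mul, mul_one]
  have n4 := norm_add_le (a * (a' - a) + b * (b' - b)) ((a * b) * ((a' - a) * b' + a * (b' - b)))
  have n5 := norm_add_le (a * (a' - a)) (b * (b' - b))
  linarith

/-- The imaginary unit `i`. -/
def quatI : ℍ := ⟨0, 1, 0, 0⟩

/-- The imaginary unit `j`. -/
def quatJ : ℍ := ⟨0, 0, 1, 0⟩

@[simp] lemma quatI_re : quatI.re = 0 := rfl
@[simp] lemma quatI_imI : quatI.imI = 1 := rfl
@[simp] lemma quatI_imJ : quatI.imJ = 0 := rfl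
@[simp] lemma quatI_imK : quatI.imK = 0 := rfl
@[simp] lemma quatJ_re : quatJ.re = 0 := rfl
@[simp] lemma quatJ_imI : quatJ.imI = 0 := rfl
@[simp] lemma quatJ_imJ : quatJ.imJ = 1 := rfl
@[simp] lemma quatJ_imK : quatJ.imK = 0 := rfl

lemma isQuaternionPair_IJ : IsQuaternionPair quatI quatJ := by
  constructor <;> ext <;> simp

lemma uniformContinuous_of_eq_off_ball {E F : Type*} [NormedAddCommGroup E] [ProperSpace E]
    [NormedAddCommGroup F] {f : E → F} (hf : Continuous f) {R : ℝ} {c : F}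
    (h : ∀ x, R ≤ ‖x‖ → f x = c) : UniformContinuous f := by
  refine hf.uniformContinuous_of_tendsto_cocompact (x := c) ?_
  refine tendsto_const_nhds.congr' ?_
  filter_upwards [tendsto_norm_cocompact_atTop.eventually_ge_atTop R] with x hx
  exact (h x hx).symm

/-- Lifting a map from the plane to the rotation group, trivial at infinity, to the quaternions. -/
theorem exists_quaternion_lift {a b : ℝ × ℝ → ℍ} (ha : Continuous a) (hb : Continuous b)
    (hab : ∀ x, IsQuaternionPair (a x) (b x)) {R : ℝ} (hR : 0 < R)
    (haR : ∀ x, R ≤ ‖x‖ → a x = quatI) (hbR : ∀ x, R ≤ ‖x‖ → b x = quatJ) :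
    ∃ q : ℝ × ℝ → ℍ, Continuous q ∧ (∀ x, ‖q x‖ = 1) ∧ (∀ x, q x * quatI = a x * q x) ∧
      (∀ x, q x * quatJ = b x * q x) ∧ ∀ x, R ≤ ‖x‖ → q x = 1 := by
  obtain ⟨δ₁, hδ₁, h₁⟩ := Metric.uniformContinuous_iff.1
    (uniformContinuous_of_eq_off_ball ha haR) 1 one_pos
  obtain ⟨δ₂, hδ₂, h₂⟩ := Metric.uniformContinuous_iff.1
    (uniformContinuous_of_eq_off_ball hb hbR) 1 one_pos
  obtain ⟨s, hs, hsδ⟩ := exists_between (lt_min hδ₁ hδ₂)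
  have hdist : ∀ x : ℝ × ℝ, dist (x.1 + s, x.2) x = s := fun x => by
    rw [Prod.dist_eq]; simp [hs.le, abs_of_pos hs]
  have hfst : ∀ x : ℝ × ℝ, R ≤ |x.1| → R ≤ ‖x‖ := fun x h => h.trans (norm_fst_le x)
  have hsnd : ∀ x : ℝ × ℝ, R ≤ |x.2| → R ≤ ‖x‖ := fun x h => h.trans (norm_snd_le x)
  have transport : ∀ n : ℕ, ∃ Q : ℝ × ℝ → ℍ, Continuous Q ∧ (∀ x, Q x ≠ 0) ∧
      (∀ x, Q x * a (x.1 + n * s, x.2) = a x * Q x) ∧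
      (∀ x, Q x * b (x.1 + n * s, x.2) = b x * Q x) ∧
      ∀ x : ℝ × ℝ, R ≤ x.1 ∨ R ≤ |x.2| → Q x = 1 := by
    intro n
    induction n with
    | zero => exact ⟨fun _ => 1, continuous_const, fun _ => one_ne_zero, by simp, by simp, by simp⟩
    | succ n ih =>
      obtain ⟨Q, hQ, hQ0, hQa, hQb, hQ1⟩ := ih
      let T : ℝ × ℝ → ℍ := fun x =>
        intertwiner (a x) (b x) (a (x.1 + s, x.2)) (b (x.1 + s, x.2))
      have hT : Continuous T := by simp only [T, intertwiner]; fun_prop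
      have hshift : ∀ x : ℝ × ℝ, (x.1 + s + n * s, x.2) = (x.1 + ((n + 1 : ℕ) : ℝ) * s, x.2) := by
        intro x; push_cast; ext <;> simp; ring
      refine ⟨fun x => (1 / 4 : ℝ) • (T x * Q (x.1 + s, x.2)), by fun_prop, fun x => ?_,
        fun x => ?_,
        fun x => ?_, fun x hx => ?_⟩
      · refine smul_ne_zero (by norm_num) (mul_ne_zero (intertwiner_ne_zero (hab _) ?_ ?_ (hab _))
          (hQ0 _))
        · rw [← dist_eq_norm]; exact h₁ ((hdist x).trans_lt (hsδ.trans_le (min_le_left _ _)))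
        · rw [← dist_eq_norm]; exact h₂ ((hdist x).trans_lt (hsδ.trans_le (min_le_right _ _)))
      · have := hQa (x.1 + s, x.2)
        simp only [hshift] at this
        rw [smul_mul_assoc, mul_smul_comm, mul_assoc, this, ← mul_assoc, ← mul_assoc,
          intertwiner_mul_left (hab x).left (hab _).left (hab _).anti]
      · have := hQb (x.1 + s, x.2)
        simp only [hshift] at this
        rw [smul_mul_assoc, mul_smul_comm, mul_assoc, this, ← mul_assoc, ← mul_assoc,
          intertwiner_mul_right (hab x).right (hab _).anti (hab _).right]
      · have e0 : R ≤ ‖x‖ := hx.elim (fun h => hfst x (h.trans (le_abs_self _))) (hsnd x)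
        have e1 : R ≤ ‖(x.1 + s, x.2)‖ := hx.elim
          (fun h => hfst _ ((by linarith : R ≤ x.1 + s).trans (le_abs_self _)))
            (hsnd (x.1 + s, x.2))
        have e2 : T x = 4 := by
          simp only [T]
          rw [haR _ e0, haR _ e1, hbR _ e0, hbR _ e1]
          exact intertwiner_self isQuaternionPair_IJ
        simp only [e2]
        rw [hQ1 (x.1 + s, x.2) (hx.imp (fun h => by change R ≤ x.1 + s; linarith) id)]
        have : (4 : ℍ) = (4 : ℝ) • 1 := by
          rw [← Algebra.algebraMap_eq_smul_one]; exact (map_ofNat (algebraMap ℝ ℍ) 4).symm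
        rw [this]
        simp
  obtain ⟨n, hn⟩ := exists_nat_gt (2 * R / s)
  rw [div_lt_iff₀ hs] at hn
  obtain ⟨Q, hQ, hQ0, hQa, hQb, hQ1⟩ := transport n
  let c : ℝ × ℝ → ℝ × ℝ := fun x => (max x.1 (-R), x.2)
  have hc : Continuous c := by fun_prop
  have hcR : ∀ x : ℝ × ℝ, R ≤ ‖((c x).1 + n * s, (c x).2)‖ := fun x => by
    refine hfst _ (le_trans ?_ (le_abs_self _))
    have := le_max_right x.1 (-R)
    simp only [c]; linarith
  have hcx : ∀ x, c x = x ∨ (R ≤ ‖x‖ ∧ R ≤ ‖c x‖) := fun x => by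
    rcases le_total (-R) x.1 with h | h
    · left; ext <;> simp [c, h]
    · right
      refine ⟨hfst x (by rw [abs_of_neg] <;> linarith), hfst _ ?_⟩
      simp only [c, max_eq_right h, abs_neg, le_abs_self]
  have hca : ∀ x, a (c x) = a x := fun x => by
    obtain h | h := hcx x
    · rw [h]
    · rw [haR _ h.1, haR _ h.2]
  have hcb : ∀ x, b (c x) = b x := fun x => by
    obtain h | h := hcx x
    · rw [h]
    · rw [hbR _ h.1, hbR _ h.2]
  have hqa : ∀ x, Q (c x) * quatI = a x * Q (c x) := fun x => by
    rw [← hca, ← hQa, haR _ (hcR x)]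
  have hqb : ∀ x, Q (c x) * quatJ = b x * Q (c x) := fun x => by
    rw [← hcb, ← hQb, hbR _ (hcR x)]
  have hqR : ∀ x, R ≤ ‖x‖ → ∃ r : ℝ, 0 < r ∧ Q (c x) = r := by
    intro x hx
    by_cases h1 : R ≤ (c x).1 ∨ R ≤ |(c x).2|
    · exact ⟨1, one_pos, by rw [hQ1 _ h1]; simp⟩
    have h2 : x.1 ≤ -R := by
      by_contra! h2
      push Not at h1
      simp only [c, max_eq_left h2.le] at h1
      refine hx.not_gt (max_lt ?_ h1.2)
      rw [Real.norm_eq_abs, abs_lt]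
      exact ⟨h2, h1.1⟩
    have hreal : ∀ y : ℝ, Q (-R, y) = ((Q (-R, y)).re : ℍ) := by
      intro y
      have hy : c (-R, y) = (-R, y) := by simp [c]
      have hR' : R ≤ ‖((-R, y) : ℝ × ℝ)‖ := hfst _ (by simp [le_abs_self])
      have h3 := hqa (-R, y)
      have h4 := hqb (-R, y)
      rw [hy] at h3 h4
      rw [haR _ hR'] at h3
      rw [hbR _ hR'] at h4
      have h5 := congrArg (fun q : ℍ => q.imJ) h3
      have h6 := congrArg (fun q : ℍ => q.imK) h3
      have h7 := congrArg (fun q : ℍ => q.imK) h4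
      simp only [Quaternion.imJ_mul, Quaternion.imK_mul, quatI_re, quatI_imI, quatI_imJ, quatI_imK,
        quatJ_re, quatJ_imI, quatJ_imJ, quatJ_imK] at h5 h6 h7
      ext <;> simp <;> linarith
    have hcont : Continuous fun y : ℝ => (Q (-R, y)).re :=
      Quaternion.continuous_re.comp (hQ.comp (by fun_prop))
    have hne : ∀ y : ℝ, (Q (-R, y)).re ≠ 0 := fun y h0 => by
      have := hreal y
      rw [h0] at this
      exact hQ0 _ (by simpa using this)
    have hpos : 0 < (Q (-R, x.2)).re := by
      by_contra! hle
      have hR1 : (Q (-R, R)).re = 1 := by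
        rw [hQ1 _ (Or.inr (le_abs_self R))]; simp
      obtain ⟨y, hy⟩ := mem_range_of_exists_le_of_exists_ge hcont ⟨x.2, hle⟩
        ⟨R, by rw [hR1]; exact zero_le_one⟩
      exact hne y hy
    refine ⟨_, hpos, ?_⟩
    have : c x = (-R, x.2) := by simp [c, h2]
    rw [this]; exact hreal _
  have hcont : Continuous fun x => ‖Q (c x)‖⁻¹ :=
    ((hQ.comp hc).norm).inv₀ fun x => norm_ne_zero_iff.2 (hQ0 _)
  refine ⟨fun x => ‖Q (c x)‖⁻¹ • Q (c x), hcont.smul (hQ.comp hc), fun x => ?_, fun x => ?_,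
    fun x => ?_, fun x hx => ?_⟩
  · rw [norm_smul, norm_inv, norm_norm, inv_mul_cancel₀ (norm_ne_zero_iff.2 (hQ0 _))]
  · rw [smul_mul_assoc, mul_smul_comm, hqa]
  · rw [smul_mul_assoc, mul_smul_comm, hqb]
  · obtain ⟨r, hr, h⟩ := hqR x hx
    simp only [h]
    rw [Quaternion.norm_coe, Real.norm_of_nonneg hr.le, ← Quaternion.coe_smul, smul_eq_mul,
      inv_mul_cancel₀ hr.ne', Quaternion.coe_one]

/-- A relative homotopy in a subtype, from a path of maps given by a function of a real
parameter. -/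
lemma homotopicRel_subtype {X E : Type*} [TopologicalSpace X] [TopologicalSpace E] {P : E → Prop}
    {f g : C(X, {e // P e})} {S : Set X} (Φ : ℝ × X → E)
    (hΦ : Continuous fun z : unitInterval × X => Φ (z.1, z.2))
    (hP : ∀ t, 0 ≤ t → t ≤ 1 → ∀ x, P (Φ (t, x))) (h0 : ∀ x, Φ (0, x) = f x)
    (h1 : ∀ x, Φ (1, x) = g x) (hS : ∀ t, 0 ≤ t → t ≤ 1 → ∀ x ∈ S, Φ (t, x) = f x) :
    f.HomotopicRel g S := by
  refine ⟨{ toFun := fun z => ⟨Φ (z.1, z.2), hP _ z.1.2.1 z.1.2.2 _⟩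
            continuous_toFun := (hΦ).subtype_mk _
            map_zero_left := fun x => Subtype.ext (h0 x)
            map_one_left := fun x => Subtype.ext (h1 x)
            prop' := fun t x hx => Subtype.ext (hS t t.2.1 t.2.2 x hx) }⟩

/-- The homotopy groups of the unit sphere of the quaternions vanish below degree three. -/
lemma homotopicRel_one_of_quaternion {q : C(ℝ × ℝ, {q : ℍ // q ≠ 0})} {S : Set (ℝ × ℝ)}
    (hq : ∀ x, ‖(q x : ℍ)‖ = 1) (hS : ∀ x ∈ S, (q x : ℍ) = 1) :
    q.HomotopicRel (ContinuousMap.const _ ⟨1, one_ne_zero⟩) S := by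
  have hqc : Continuous fun x => (q x : ℍ) := continuous_subtype_val.comp q.continuous
  obtain ⟨p, hp, hpq, hps⟩ := Continuous.exists_contDiff_approx (E := ℝ × ℝ) (F := ℍ) 1
    (f := fun x => (q x : ℍ) - 1) (ε := fun _ => 1) (by fun_prop) continuous_const
    (fun _ => one_pos)
  have hpS : ∀ x ∈ S, p x = 0 := fun x hx => by
    by_contra h
    exact hps h (by simp [hS x hx])
  have hp0 : ∀ x, 1 + p x ≠ 0 := fun x h => by
    have := hpq x
    rw [dist_eq_norm, (eq_neg_of_add_eq_zero_right h : p x = -1)] at this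
    have e : (-1 : ℍ) - ((q x : ℍ) - 1) = - q x := by abel
    rw [e, norm_neg, hq] at this
    exact this.false
  let r : C(ℝ × ℝ, {q : ℍ // q ≠ 0}) :=
    ⟨fun x => ⟨1 + p x, hp0 x⟩, (by have := hp.continuous; fun_prop)⟩
  refine ContinuousMap.HomotopicRel.trans (g := r) ?_ ?_
  · refine homotopicRel_subtype (fun z => (q z.2 : ℍ) + z.1 • (1 + p z.2 - q z.2)) ?_ ?_ ?_ ?_ ?_
    · have := hp.continuous; fun_prop
    · intro t ht0 ht1 x h
      have h1 : ‖t • (1 + p x - q x)‖ = 1 := by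
        rw [← norm_neg, ← hq x]; congr 1; exact (eq_neg_of_add_eq_zero_left h).symm
      have h2 := hpq x
      have e : p x - ((q x : ℍ) - 1) = 1 + p x - q x := by abel
      rw [dist_eq_norm, e] at h2
      rw [norm_smul, Real.norm_of_nonneg ht0] at h1
      nlinarith [norm_nonneg (1 + p x - q x)]
    · intro x; simp
    · intro x; simp [r]
    · intro t _ _ x hx
      simp [hpS x hx, hS x hx]
  · have hd : Dense (Set.range fun z : ℝ × ℝ × ℝ => z.1 • (1 + p z.2))ᶜ := by
      refine ContDiff.dense_compl_range_of_finrank_lt_finrank ?_ ?_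
      · have hp' : ContDiff ℝ 1 p := hp
        fun_prop
      · rw [Quaternion.finrank_eq_four]; simp
    obtain ⟨e, he, he1⟩ := hd.exists_dist_lt (1 : ℍ) one_pos
    have he2 : ∀ r x, e ≠ r • (1 + p x) := fun r x h => he ⟨(r, x), h.symm⟩
    have hD : ∀ t : ℝ, 0 ≤ t → t ≤ 1 → (1 - t) • 1 + t • e ≠ 0 := by
      intro t ht0 ht1 h
      have h1 : t • (1 - e) = 1 := by
        rw [← sub_eq_zero, ← neg_eq_zero, ← h]; module
      have h2 := congrArg norm h1
      rw [norm_smul, Real.norm_of_nonneg ht0, norm_one, ← dist_eq_norm] at h2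
      nlinarith [dist_nonneg (x := (1 : ℍ)) (y := e)]
    refine homotopicRel_subtype
      (fun z => ((1 - z.1) • (1 + p z.2) + z.1 • e) * ((1 - z.1) • 1 + z.1 • e)⁻¹) ?_ ?_ ?_ ?_ ?_
    · have := hp.continuous
      refine Continuous.mul (by fun_prop) (Continuous.inv₀ (by fun_prop) fun z => ?_)
      exact hD _ z.1.2.1 z.1.2.2
    · intro t ht0 ht1 x
      refine mul_ne_zero (fun h => ?_) (inv_ne_zero (hD t ht0 ht1))
      rcases ht0.eq_or_lt with rfl | ht
      · exact hp0 x (by simpa using h)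
      · refine he2 (-(t⁻¹ * (1 - t))) x ?_
        have h3 : t⁻¹ • ((1 - t) • (1 + p x) + t • e) = 0 := by rw [h, smul_zero]
        rw [smul_add, smul_smul, smul_smul, inv_mul_cancel₀ ht.ne', one_smul] at h3
        rw [neg_smul]
        exact eq_neg_of_add_eq_zero_right h3
    · intro x; simp [r]
    · intro x
      have : e ≠ 0 := fun h => he2 0 0 (by simp [h])
      simp [this]
    · intro t ht0 ht1 x hx
      simp only [r, ContinuousMap.coe_mk, hpS x hx, add_zero]
      exact mul_inv_cancel₀ (hD t ht0 ht1)
/-- The rotation (up to scale) attached to a quaternion, applied to the first two basis vectors. -/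
def quatFrame : C({q : ℍ // q ≠ 0}, Frame) where
  toFun q := ⟨(![(q * quatI * star (q : ℍ)).imI, (q * quatI * star (q : ℍ)).imJ,
    (q * quatI * star (q : ℍ)).imK], ![(q * quatJ * star (q : ℍ)).imI,
    (q * quatJ * star (q : ℍ)).imJ, (q * quatJ * star (q : ℍ)).imK]), by
      obtain ⟨q, hq⟩ := q
      intro h
      have h1 : (Quaternion.normSq q) ^ 4 = 0 := by
        have h2 := congrArg (fun v => v ⬝ᵥ v) h
        rw [Quaternion.normSq_def']
        simp [cross_apply] at h2
        linear_combination h2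
      exact hq (Quaternion.normSq_eq_zero.1 (pow_eq_zero_iff (by norm_num) |>.1 h1))⟩
  continuous_toFun := by
    have h1 : Continuous fun q : {q : ℍ // q ≠ 0} => (q * quatI * star (q : ℍ)) := by fun_prop
    have h2 : Continuous fun q : {q : ℍ // q ≠ 0} => (q * quatJ * star (q : ℍ)) := by fun_prop
    have c1 := Quaternion.continuous_imI
    have c2 := Quaternion.continuous_imJ
    have c3 := Quaternion.continuous_imK
    refine Continuous.subtype_mk (Continuous.prodMk ?_ ?_) _ <;>
    · refine continuous_pi fun i => ?_
      fin_cases i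
      exacts [c1.comp ‹_›, c2.comp ‹_›, c3.comp ‹_›]

/-- The first two standard basis vectors. -/
def stdFrame : Frame := ⟨(![1, 0, 0], ![0, 1, 0]), by simp [cross_apply]⟩

lemma isQuaternionPair_of_orthonormal {a b : ℍ} (ha : a.re = 0) (hb : b.re = 0)
    (h1 : a.imI * a.imI + a.imJ * a.imJ + a.imK * a.imK = 1)
    (h2 : b.imI * b.imI + b.imJ * b.imJ + b.imK * b.imK = 1)
    (h12 : a.imI * b.imI + a.imJ * b.imJ + a.imK * b.imK = 0) : IsQuaternionPair a b := by
  constructor <;> ext <;> simp [ha, hb] <;> linarith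

lemma homotopicRel_const_of_orthonormal {m : C(ℝ × ℝ, Frame)} {R : ℝ} (hR : 0 < R)
    (hm : ∀ x, R ≤ ‖x‖ → m x = stdFrame) (h1 : ∀ x, (m x).1.1 ⬝ᵥ (m x).1.1 = 1)
    (h2 : ∀ x, (m x).1.2 ⬝ᵥ (m x).1.2 = 1) (h12 : ∀ x, (m x).1.1 ⬝ᵥ (m x).1.2 = 0) :
    m.HomotopicRel (.const _ stdFrame) {x | R ≤ ‖x‖} := by
  let toQ : (Fin 3 → ℝ) → ℍ := fun v => ⟨0, v 0, v 1, v 2⟩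
  have hmc : Continuous fun x => (m x).1 := continuous_subtype_val.comp m.continuous
  have hto : ∀ {v : ℝ × ℝ → Fin 3 → ℝ}, Continuous v → Continuous fun x => toQ (v x) := by
    intro v hv
    have e : (fun x => toQ (v x)) =
        fun x => v x 0 • quatI + v x 1 • quatJ + v x 2 • (quatI * quatJ) := by
      funext x; ext <;> simp [toQ]
    rw [e]; fun_prop
  have hpair : ∀ x, IsQuaternionPair (toQ (m x).1.1) (toQ (m x).1.2) := by
    intro x
    have a1 := h1 x
    have a2 := h2 x
    have a3 := h12 x
    simp only [Matrix.vec3_dotProduct] at a1 a2 a3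
    exact isQuaternionPair_of_orthonormal rfl rfl a1 a2 a3
  have ha : ∀ x, R ≤ ‖x‖ → toQ (m x).1.1 = quatI := by
    intro x hx; rw [hm x hx]; ext <;> simp [toQ, stdFrame]
  have hb : ∀ x, R ≤ ‖x‖ → toQ (m x).1.2 = quatJ := by
    intro x hx; rw [hm x hx]; ext <;> simp [toQ, stdFrame]
  obtain ⟨q, hq, hq1, hqa, hqb, hqR⟩ :=
    exists_quaternion_lift (hto hmc.fst) (hto hmc.snd) hpair hR ha hb
  let Q : C(ℝ × ℝ, {q : ℍ // q ≠ 0}) :=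
    ⟨fun x => ⟨q x, fun h => by simpa [h] using hq1 x⟩, hq.subtype_mk _⟩
  have key := (homotopicRel_one_of_quaternion (q := Q) (S := {x | R ≤ ‖x‖}) hq1
    fun x hx => hqR x hx).comp_continuousMap quatFrame
  have hqq : ∀ x, q x * star (q x) = 1 := fun x => by
    rw [Quaternion.self_mul_star, Quaternion.normSq_eq_norm_mul_self, hq1]; simp
  have e1 : quatFrame.comp Q = m := by
    ext1 x
    refine Subtype.ext (Prod.ext ?_ ?_)
    · ext i; simp only [quatFrame, Q, ContinuousMap.comp_apply, ContinuousMap.coe_mk, hqa]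
      rw [mul_assoc, hqq, mul_one]
      fin_cases i <;> rfl
    · ext i; simp only [quatFrame, Q, ContinuousMap.comp_apply, ContinuousMap.coe_mk, hqb]
      rw [mul_assoc, hqq, mul_one]
      fin_cases i <;> rfl
  have e2 : quatFrame.comp (.const _ ⟨1, one_ne_zero⟩) = .const (ℝ × ℝ) stdFrame := by
    ext1 x
    refine Subtype.ext (Prod.ext ?_ ?_) <;>
    · ext i; fin_cases i <;> simp [quatFrame, stdFrame]
  rwa [e1, e2] at key

lemma homotopicRel_const_stdFrame {m : C(ℝ × ℝ, Frame)} {R : ℝ} (hR : 0 < R)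
    (hm : ∀ x, R ≤ ‖x‖ → m x = stdFrame) :
    m.HomotopicRel (.const _ stdFrame) {x | R ≤ ‖x‖} := by
  have hmc : Continuous fun x => (m x).1 := continuous_subtype_val.comp m.continuous
  have hpos : ∀ v : Fin 3 → ℝ, v ≠ 0 → 0 < v ⬝ᵥ v := fun v hv =>
    lt_of_le_of_ne (by
      rw [Matrix.vec3_dotProduct]
      nlinarith [sq_nonneg (v 0), sq_nonneg (v 1), sq_nonneg (v 2)])
      fun h => hv (dotProduct_self_eq_zero.1 h.symm)
  let u : ℝ × ℝ → Fin 3 → ℝ := fun x => (m x).1.1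
  let v : ℝ × ℝ → Fin 3 → ℝ := fun x => (m x).1.2
  let n : ℝ × ℝ → Fin 3 → ℝ := fun x => u x ⨯₃ v x
  have hn : ∀ x, n x ≠ 0 := fun x => (m x).2
  have hu : ∀ x, u x ≠ 0 := fun x h => hn x (by simp [n, h])
  let α : ℝ × ℝ → ℝ := fun x => √(u x ⬝ᵥ u x)
  let β : ℝ × ℝ → ℝ := fun x => √(n x ⬝ᵥ n x)
  have hα : ∀ x, 0 < α x := fun x => Real.sqrt_pos.2 (hpos _ (hu x))
  have hβ : ∀ x, 0 < β x := fun x => Real.sqrt_pos.2 (hpos _ (hn x))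
  have hα2 : ∀ x, u x ⬝ᵥ u x = α x ^ 2 := fun x => (Real.sq_sqrt (hpos _ (hu x)).le).symm
  have hβ2 : ∀ x, n x ⬝ᵥ n x = β x ^ 2 := fun x => (Real.sq_sqrt (hpos _ (hn x)).le).symm
  have hnu : ∀ x, n x ⬝ᵥ u x = 0 := fun x => by
    rw [dotProduct_comm]; exact dot_self_cross _ _
  have huc : Continuous u := hmc.fst
  have hvc : Continuous v := hmc.snd
  have hnc : Continuous n := huc.crossProd hvc
  have hαc : Continuous α := (huc.dotProduct huc).sqrt
  have hβc : Continuous β := (hnc.dotProduct hnc).sqrt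
  let uo : ℝ × ℝ → Fin 3 → ℝ := fun x => (α x)⁻¹ • u x
  let vo : ℝ × ℝ → Fin 3 → ℝ := fun x => (α x * β x)⁻¹ • (n x ⨯₃ u x)
  have huoc : Continuous uo := (hαc.inv₀ fun x => (hα x).ne').smul huc
  have hvoc : Continuous vo := ((hαc.mul hβc).inv₀ fun x => (mul_pos (hα x) (hβ x)).ne').smul
    (hnc.crossProd huc)
  have hcross : ∀ x, u x ⨯₃ (n x ⨯₃ u x) = (α x ^ 2) • n x := fun x => by
    rw [cross_cross_eq_smul_sub_smul', hα2, hnu]; simp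
  have key : ∀ t : ℝ, 0 ≤ t → t ≤ 1 → ∀ x,
      ((1 - t) • u x + t • uo x) ⨯₃ ((1 - t) • v x + t • vo x) ≠ 0 := by
    intro t ht0 ht1 x
    have e : ((1 - t) • u x + t • uo x) ⨯₃ ((1 - t) • v x + t • vo x) =
        (((1 - t) + t * (α x)⁻¹) * ((1 - t) + t * ((α x * β x)⁻¹ * α x ^ 2))) • n x := by
      have e1 : (1 - t) • u x + t • uo x = ((1 - t) + t * (α x)⁻¹) • u x := by
        simp only [uo]; module
      rw [e1]
      have e2 : u x ⨯₃ v x = n x := rfl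
      simp only [vo, map_smul, LinearMap.smul_apply, map_add, hcross, e2]
      module
    rw [e]
    have p1 : 0 < (α x)⁻¹ := inv_pos.2 (hα x)
    have p2 : 0 < (α x * β x)⁻¹ * α x ^ 2 :=
      mul_pos (inv_pos.2 (mul_pos (hα x) (hβ x))) (pow_pos (hα x) 2)
    have p : ∀ c : ℝ, 0 < c → 0 < (1 - t) + t * c := fun c hc => by
      rcases ht1.eq_or_lt with rfl | h
      · simpa using hc
      · have := mul_nonneg ht0 hc.le; linarith
    exact smul_ne_zero (mul_pos (p _ p1) (p _ p2)).ne' (hn x)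
  have huoS : ∀ x, R ≤ ‖x‖ → uo x = u x ∧ vo x = v x := fun x hx => by
    have e1 : u x = ![1, 0, 0] := by simp [u, hm x hx, stdFrame]
    have e2 : v x = ![0, 1, 0] := by simp [v, hm x hx, stdFrame]
    have e3 : n x = ![0, 0, 1] := by simp [n, e1, e2, cross_apply]
    have e4 : α x = 1 := by simp [α, e1]
    have e5 : β x = 1 := by simp [β, e3]
    simp only [uo, vo, e4, e5, e1, e2, e3, cross_apply]
    simp
  have hk : ∀ x, uo x ⨯₃ vo x ≠ 0 := fun x => by simpa using key 1 zero_le_one le_rfl x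
  let m' : C(ℝ × ℝ, Frame) := ⟨fun x => ⟨(uo x, vo x), hk x⟩, (huoc.prodMk hvoc).subtype_mk hk⟩
  refine ContinuousMap.HomotopicRel.trans (g := m') ?_
    (homotopicRel_const_of_orthonormal hR ?_ ?_ ?_ ?_)
  · refine homotopicRel_subtype
      (fun z => ((1 - z.1) • u z.2 + z.1 • uo z.2, (1 - z.1) • v z.2 + z.1 • vo z.2))
      (by fun_prop) key ?_ ?_ ?_
    · intro x; simp [u, v]
    · intro x; simp [m']
    · intro t _ _ x hx
      rw [(huoS x hx).1, (huoS x hx).2]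
      ext1 <;> simp only [u, v] <;> module
  · intro x hx
    rw [← hm x hx]
    exact Subtype.ext (Prod.ext (huoS x hx).1 (huoS x hx).2)
  · intro x
    have := (hα x).ne'
    change uo x ⬝ᵥ uo x = 1
    simp only [uo, smul_dotProduct, dotProduct_smul, hα2, smul_eq_mul]
    field_simp
  · intro x
    have h1 := (hα x).ne'
    have h2 := (hβ x).ne'
    change vo x ⬝ᵥ vo x = 1
    simp only [vo, smul_dotProduct, dotProduct_smul, smul_eq_mul, cross_dot_cross, hα2, hβ2, hnu]
    field_simp
    simp
  · intro x
    change uo x ⬝ᵥ vo x = 0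
    simp [uo, vo]

/-- Any two frame fields on the plane that agree outside a ball are homotopic relative to the
complement of the ball. -/
theorem homotopicRel_of_eq_off_ball {A B : C(ℝ × ℝ, Frame)} {R : ℝ} (hR : 0 < R)
    (h : ∀ x, R ≤ ‖x‖ → A x = B x) : A.HomotopicRel B {x | R ≤ ‖x‖} := by
  have hAc : Continuous fun x => (A x).1 := continuous_subtype_val.comp A.continuous
  have hBc : Continuous fun x => (B x).1 := continuous_subtype_val.comp B.continuous
  let N : ℝ × ℝ → Matrix (Fin 3) (Fin 3) ℝ := fun x =>
    (Matrix.of ![(A x).1.1, (A x).1.2, (A x).1.1 ⨯₃ (A x).1.2])ᵀ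
  have hNc : Continuous N := by
    refine Continuous.matrix_transpose (continuous_matrix fun i j => ?_)
    have h1 := hAc.fst
    have h2 := hAc.snd
    have h3 := h1.crossProd h2
    fin_cases i
    exacts [(continuous_apply j).comp h1, (continuous_apply j).comp h2,
      (continuous_apply j).comp h3]
  have hdet : ∀ x, (N x).det ≠ 0 := fun x => by
    rw [Matrix.det_transpose]
    change Matrix.det ![_, _, _] ≠ 0
    rw [← triple_product_eq_det, triple_product_permutation, triple_product_permutation]
    exact fun h => (A x).2 (dotProduct_self_eq_zero.1 h)
  have hN1 : ∀ x, N x *ᵥ ![1, 0, 0] = (A x).1.1 := fun x => by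
    ext i; simp [N, Matrix.mulVec]
  have hN2 : ∀ x, N x *ᵥ ![0, 1, 0] = (A x).1.2 := fun x => by
    ext i; simp [N, Matrix.mulVec]
  have hI : ∀ M : Matrix (Fin 3) (Fin 3) ℝ, M.det ≠ 0 → ∀ a b : Fin 3 → ℝ, a ⨯₃ b ≠ 0 →
      (M *ᵥ a) ⨯₃ (M *ᵥ b) ≠ 0 := by
    intro M hM a b hab
    rw [crossProduct_ne_zero_iff_linearIndependent] at hab ⊢
    have := hab.map' (Matrix.toLin' M) (LinearMap.ker_eq_bot.2 (by
      simpa using! Matrix.mulVec_injective_of_isUnit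
        ((Matrix.isUnit_iff_isUnit_det M).2 hM.isUnit)))
    have e : ![M *ᵥ a, M *ᵥ b] = Matrix.toLin' M ∘ ![a, b] := by
      ext1 i; fin_cases i <;> rfl
    rw [e]; exact this
  have hNi : ∀ x v, N x *ᵥ ((N x)⁻¹ *ᵥ v) = v := fun x v => by
    rw [Matrix.mulVec_mulVec, Matrix.mul_nonsing_inv _ (hdet x).isUnit, Matrix.one_mulVec]
  have hNi' : ∀ x v, (N x)⁻¹ *ᵥ (N x *ᵥ v) = v := fun x v => by
    rw [Matrix.mulVec_mulVec, Matrix.nonsing_inv_mul _ (hdet x).isUnit, Matrix.one_mulVec]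
  have hNic : Continuous fun x => (N x)⁻¹ := by
    simp only [Matrix.inv_def, Ring.inverse_eq_inv']
    exact (hNc.matrix_det.inv₀ hdet).smul hNc.matrix_adjugate
  let M : C(ℝ × ℝ, Frame) := ⟨fun x => ⟨((N x)⁻¹ *ᵥ (B x).1.1, (N x)⁻¹ *ᵥ (B x).1.2),
    hI _ (by rw [Matrix.det_nonsing_inv]; simpa using hdet x) _ _ (B x).2⟩,
    ((hNic.matrix_mulVec hBc.fst).prodMk (hNic.matrix_mulVec hBc.snd)).subtype_mk _⟩
  obtain ⟨H⟩ := homotopicRel_const_stdFrame (m := M) hR fun x hx => by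
    refine Subtype.ext ?_
    simp only [M, ContinuousMap.coe_mk, stdFrame]
    rw [← h x hx, ← hN1, ← hN2, hNi', hNi']
  have hHc : Continuous fun z => (H z).1 := continuous_subtype_val.comp H.continuous
  refine ContinuousMap.HomotopicRel.symm ⟨{
    toFun := fun z => ⟨(N z.2 *ᵥ (H z).1.1, N z.2 *ᵥ (H z).1.2), hI _ (hdet _) _ _ (H z).2⟩
    continuous_toFun := (((hNc.comp continuous_snd).matrix_mulVec hHc.fst).prodMk
      ((hNc.comp continuous_snd).matrix_mulVec hHc.snd)).subtype_mk _
    map_zero_left := fun x => Subtype.ext ?_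
    map_one_left := fun x => Subtype.ext ?_
    prop' := fun t x hx => Subtype.ext ?_ }⟩
  · simp [M, hNi]
  · have := H.apply_one x
    change (N x *ᵥ (H (1, x)).1.1, N x *ᵥ (H (1, x)).1.2) = _
    rw [show H (1, x) = stdFrame from this]
    simp [stdFrame, hN1, hN2]
  · have := H.eq_fst t hx
    simp only [ContinuousMap.coe_mk]
    rw [this]
    simp [M, hNi]

/-- Immersions of the plane that agree outside a ball are regularly homotopic relative to the
complement of the ball. -/
theorem exists_regularHomotopy_of_eq_off_ball {g₀ g₁ : ℝ × ℝ → Fin 3 → ℝ}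
    (h₀ : PlaneImmersion g₀) (h₁ : PlaneImmersion g₁) {K : Set (ℝ × ℝ)} (hK : IsCompact K)
    (hgK : ∀ x ∉ K, g₀ x = g₁ x) :
    ∃ (R : ℝ) (G : ℝ × ℝ × ℝ → Fin 3 → ℝ), ContDiff ℝ 1 G ∧ (∀ x, G (-1, x) = g₀ x) ∧
      (∀ x, G (2, x) = g₁ x) ∧ (∀ t x, R < ‖x‖ → G (t, x) = g₀ x) ∧
      ∀ t, PlaneImmersion fun x => G (t, x) := by
  obtain ⟨r, hr, hKr⟩ := hK.isBounded.subset_closedBall_lt 0 0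
  have hout : ∀ x, r < ‖x‖ → x ∉ K := fun x hx hxK => by
    have := hKr hxK
    rw [mem_closedBall_zero_iff] at this
    exact this.not_gt hx
  have hfr : ∀ x, r + 1 ≤ ‖x‖ → h₀.frame x = h₁.frame x := fun x hx => by
    have : fderiv ℝ g₀ x = fderiv ℝ g₁ x := by
      refine Filter.EventuallyEq.fderiv_eq ?_
      filter_upwards [(isOpen_lt continuous_const continuous_norm).mem_nhds
        (show r < ‖x‖ by linarith)] with y hy using hgK y (hout y hy)
    exact Subtype.ext (by simp [PlaneImmersion.frame, this])
  obtain ⟨G, hG, hG0, hG1, hGK, hGi⟩ := exists_regularHomotopy_of_homotopicRel h₀ h₁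
    (isCompact_closedBall (0 : ℝ × ℝ) (r + 1))
    (fun x hx => hgK x (hout x (by
      rw [mem_closedBall_zero_iff, not_le] at hx; linarith)))
    ((homotopicRel_of_eq_off_ball (by positivity) hfr).map fun H => ⟨H.1, fun t x hx => H.2 t x (by
      rw [Set.mem_compl_iff, mem_closedBall_zero_iff, not_le] at hx; exact hx.le)⟩)
  exact ⟨r + 1, G, hG, hG0, hG1, fun t x hx => hGK t x (by
    rwa [mem_closedBall_zero_iff, not_le]), hGi⟩

lemma tangentMap_slice {F : ℝ × S2 → E3}
    (hF : ContMDiff (𝓘(ℝ, ℝ).prod (𝓡 2)) 𝓘(ℝ, E3) 1 F) (t : ℝ) (z : TangentBundle (𝓡 2) S2) :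
    tangentMap (𝓡 2) 𝓘(ℝ, E3) (fun x => F (t, x)) z =
      tangentMap (𝓘(ℝ, ℝ).prod (𝓡 2)) 𝓘(ℝ, E3) F
        ((equivTangentBundleProd 𝓘(ℝ, ℝ) ℝ (𝓡 2) S2).symm (⟨t, 0⟩, z)) := by
  have h1 : MDifferentiableAt (𝓘(ℝ, ℝ).prod (𝓡 2)) 𝓘(ℝ, E3) F (t, z.1) :=
    (hF _).mdifferentiableAt one_ne_zero
  have h2 : HasMFDerivAt (𝓡 2) (𝓘(ℝ, ℝ).prod (𝓡 2)) (fun x : S2 => (t, x)) z.1 _ :=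
    (hasMFDerivAt_const t z.1).prodMk (hasMFDerivAt_id z.1)
  have h3 := (h1.hasMFDerivAt.comp z.1 h2).mfderiv
  refine Bundle.TotalSpace.ext rfl (heq_of_eq ?_)
  change mfderiv (𝓡 2) 𝓘(ℝ, E3) (F ∘ fun x => (t, x)) z.1 z.2 = _
  rw [h3]
  rfl

lemma contMDiff_slice {F : ℝ × S2 → E3}
    (hF : ContMDiff (𝓘(ℝ, ℝ).prod (𝓡 2)) 𝓘(ℝ, E3) 1 F) (t : ℝ) :
    ContMDiff (𝓡 2) 𝓘(ℝ, E3) 1 fun x => F (t, x) :=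
  hF.comp (contMDiff_const.prodMk contMDiff_id)

/-- A regular homotopy relative to the base point is a path of pointed immersions. -/
lemma PointedImm.joined_of_contMDiff {p : S2} {f₀ f₁ : PointedImm p} {F : ℝ × S2 → E3}
    (hF : ContMDiff (𝓘(ℝ, ℝ).prod (𝓡 2)) 𝓘(ℝ, E3) 1 F)
    (hinj : ∀ t x, Injective (mfderiv (𝓡 2) 𝓘(ℝ, E3) (fun x => F (t, x)) x))
    (hp : ∀ t, F (t, p) = stdEmb p)
    (hdp : ∀ t, mfderiv (𝓡 2) 𝓘(ℝ, E3) (fun x => F (t, x)) p =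
      mfderiv (𝓡 2) 𝓘(ℝ, E3) stdEmb p)
    (h₀ : ∀ x, F (0, x) = f₀.1 x) (h₁ : ∀ x, F (1, x) = f₁.1 x) : Joined f₀ f₁ := by
  let γ : unitInterval → PointedImm p := fun t =>
    ⟨fun x => F (t, x), ⟨contMDiff_slice hF t, hinj t⟩, hp t, (hdp t).trans rfl⟩
  have hγ : Continuous γ := by
    refine continuous_induced_rng.2 (ContinuousMap.continuous_of_continuous_uncurry _ ?_)
    have e : (Function.uncurry fun (t : unitInterval) (z : TangentBundle (𝓡 2) S2) =>
        tangentMap (𝓡 2) 𝓘(ℝ, E3) (fun x => F (t, x)) z) = fun z =>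
        tangentMap (𝓘(ℝ, ℝ).prod (𝓡 2)) 𝓘(ℝ, E3) F
          ((equivTangentBundleProd 𝓘(ℝ, ℝ) ℝ (𝓡 2) S2).symm (⟨(z.1 : ℝ), 0⟩, z.2)) :=
      funext fun z => tangentMap_slice hF z.1 z.2
    change Continuous (Function.uncurry fun (t : unitInterval) (z : TangentBundle (𝓡 2) S2) =>
        tangentMap (𝓡 2) 𝓘(ℝ, E3) (fun x => F (t, x)) z)
    rw [e]
    refine (hF.continuous_tangentMap le_rfl).comp
      ((contMDiff_equivTangentBundleProd_symm (n := 0)).continuous.comp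
        (Continuous.prodMk ?_ continuous_snd))
    have hz : Continuous fun t : ℝ => (⟨t, 0⟩ : TangentBundle 𝓘(ℝ, ℝ) ℝ) :=
      (Bundle.contMDiff_zeroSection (n := 0) (IB := 𝓘(ℝ, ℝ)) (F := ℝ) ℝ
        (TangentSpace 𝓘(ℝ, ℝ) : ℝ → Type)).continuous
    exact hz.comp (continuous_subtype_val.comp continuous_fst)
  exact ⟨⟨⟨γ, hγ⟩, Subtype.ext (funext fun x => by simpa [γ] using h₀ x),
    Subtype.ext (funext fun x => by simpa [γ] using h₁ x)⟩⟩

abbrev E2 := EuclideanSpace ℝ (Fin 2)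

lemma stereographic_mem_maximalAtlas (q : S2) (n : ℕ∞ω) :
    (stereographic' 2 q : OpenPartialHomeomorph S2 E2) ∈ IsManifold.maximalAtlas (𝓡 2) n S2 :=
  IsManifold.subset_maximalAtlas ⟨q, rfl⟩

lemma contMDiff_stereographic_symm (q : S2) :
    ContMDiff 𝓘(ℝ, E2) (𝓡 2) 1 (stereographic' 2 q : OpenPartialHomeomorph S2 E2).symm := by
  have := contMDiffOn_symm_of_mem_maximalAtlas (stereographic_mem_maximalAtlas q 1)
  rwa [stereographic'_target, contMDiffOn_univ] at this

lemma contMDiffAt_stereographic {q x : S2} (hx : x ≠ q) :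
    ContMDiffAt (𝓡 2) 𝓘(ℝ, E2) 1 (stereographic' 2 q : OpenPartialHomeomorph S2 E2) x :=
  contMDiffAt_of_mem_maximalAtlas (stereographic_mem_maximalAtlas q 1) (by simpa using hx)

lemma mdifferentiable_stereographic (q : S2) :
    (stereographic' 2 q : OpenPartialHomeomorph S2 E2).MDifferentiable (𝓡 2) 𝓘(ℝ, E2) :=
  mdifferentiable_of_mem_atlas (I := 𝓡 2) ⟨q, rfl⟩

lemma stereographic_symm_ne (q : S2) (y : E2) :
    (stereographic' 2 q : OpenPartialHomeomorph S2 E2).symm y ≠ q := by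
  have := (stereographic' 2 q : OpenPartialHomeomorph S2 E2).map_target (x := y) (by simp)
  simpa using this

lemma stereographic_symm_apply {q x : S2} (hx : x ≠ q) :
    (stereographic' 2 q : OpenPartialHomeomorph S2 E2).symm (stereographic' 2 q x) = x :=
  (stereographic' 2 q : OpenPartialHomeomorph S2 E2).left_inv (by simpa using hx)

lemma stereographic_apply_symm (q : S2) (y : E2) :
    stereographic' 2 q ((stereographic' 2 q : OpenPartialHomeomorph S2 E2).symm y) = y :=
  (stereographic' 2 q : OpenPartialHomeomorph S2 E2).right_inv (by simp)

lemma IsImmersionS2.contDiff_comp_symm {f : S2 → E3} (hf : IsImmersionS2 f) (q : S2) :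
    ContDiff ℝ 1 fun y => f ((stereographic' 2 q : OpenPartialHomeomorph S2 E2).symm y) :=
  (hf.1.comp (contMDiff_stereographic_symm q)).contDiff

lemma injective_fderiv_comp_symm {f : S2 → E3} {q : S2} {y : E2}
    (hf : MDifferentiableAt (𝓡 2) 𝓘(ℝ, E3) f
      ((stereographic' 2 q : OpenPartialHomeomorph S2 E2).symm y))
    (hi : Injective (mfderiv (𝓡 2) 𝓘(ℝ, E3) f
      ((stereographic' 2 q : OpenPartialHomeomorph S2 E2).symm y))) :
    Injective (fderiv ℝ
      (fun y => f ((stereographic' 2 q : OpenPartialHomeomorph S2 E2).symm y)) y) := by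
  have h := mfderiv_comp y hf ((contMDiff_stereographic_symm q y).mdifferentiableAt one_ne_zero)
  have h2 := (mdifferentiable_stereographic q).symm.mfderiv_injective (x := y) (by simp)
  rw [← mfderiv_eq_fderiv]
  change Injective (mfderiv 𝓘(ℝ, E2) 𝓘(ℝ, E3) (f ∘ _) y)
  rw [h]
  exact hi.comp h2

lemma mfderiv_eq_comp_stereographic {f : S2 → E3} {q x : S2} (hx : x ≠ q)
    (hf : DifferentiableAt ℝ
      (fun y => f ((stereographic' 2 q : OpenPartialHomeomorph S2 E2).symm y))
      (stereographic' 2 q x)) :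
    mfderiv (𝓡 2) 𝓘(ℝ, E3) f x = (fderiv ℝ
      (fun y => f ((stereographic' 2 q : OpenPartialHomeomorph S2 E2).symm y))
      (stereographic' 2 q x)).comp
      (mfderiv (𝓡 2) 𝓘(ℝ, E2) (stereographic' 2 q : OpenPartialHomeomorph S2 E2) x) := by
  have h := mfderiv_comp x (I' := 𝓘(ℝ, E2)) hf.mdifferentiableAt
    ((contMDiffAt_stereographic hx).mdifferentiableAt one_ne_zero)
  have h2 : f =ᶠ[𝓝 x] (fun y => f ((stereographic' 2 q : OpenPartialHomeomorph S2 E2).symm y)) ∘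
      (stereographic' 2 q : OpenPartialHomeomorph S2 E2) := by
    filter_upwards [isOpen_ne.mem_nhds hx] with z hz
    simp [stereographic_symm_apply hz]
  rw [← mfderiv_eq_fderiv]
  exact h2.mfderiv_eq.trans h

lemma injective_mfderiv_of_stereographic {f : S2 → E3} {q x : S2} (hx : x ≠ q)
    (hf : Injective (fderiv ℝ
      (fun y => f ((stereographic' 2 q : OpenPartialHomeomorph S2 E2).symm y))
      (stereographic' 2 q x)))
    (hd : DifferentiableAt ℝ
      (fun y => f ((stereographic' 2 q : OpenPartialHomeomorph S2 E2).symm y))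
      (stereographic' 2 q x)) :
    Injective (mfderiv (𝓡 2) 𝓘(ℝ, E3) f x) := by
  rw [mfderiv_eq_comp_stereographic hx hd]
  exact hf.comp ((mdifferentiable_stereographic q).mfderiv_injective (by simpa using hx))

/-- The homotopy of maps on the sphere which is `Φ` in the stereographic chart centred at `q`,
and agrees with `f` at `q`. -/
def glue (q : S2) (f : S2 → E3) (Φ : ℝ × E2 → E3) (z : ℝ × S2) : E3 :=
  open Classical in if z.2 = q then f q else Φ (z.1, stereographic' 2 q z.2)

section Glue

variable {q : S2} {f : S2 → E3} {Φ : ℝ × E2 → E3} {K : Set E2}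

lemma glue_of_ne {x : S2} (hx : x ≠ q) (t : ℝ) :
    glue q f Φ (t, x) = Φ (t, stereographic' 2 q x) := by
  simp [glue, hx]

lemma glue_symm (t : ℝ) (y : E2) :
    glue q f Φ (t, (stereographic' 2 q : OpenPartialHomeomorph S2 E2).symm y) = Φ (t, y) := by
  rw [glue_of_ne (stereographic_symm_ne q y), stereographic_apply_symm]

lemma eventually_glue_eq (hK : IsCompact K)
    (hΦ : ∀ t, ∀ y ∉ K, Φ (t, y) = f ((stereographic' 2 q : OpenPartialHomeomorph S2 E2).symm y)) :
    ∀ᶠ x in 𝓝 q, ∀ t, glue q f Φ (t, x) = f x := by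
  have hc : IsCompact ((stereographic' 2 q : OpenPartialHomeomorph S2 E2).symm '' K) :=
    hK.image (contMDiff_stereographic_symm q).continuous
  have hq : q ∉ (stereographic' 2 q : OpenPartialHomeomorph S2 E2).symm '' K := by
    rintro ⟨y, -, hy⟩
    exact stereographic_symm_ne q y hy
  filter_upwards [hc.isClosed.isOpen_compl.mem_nhds hq] with x hx t
  by_cases hxq : x = q
  · simp [glue, hxq]
  · rw [glue_of_ne hxq, hΦ t _ fun h => hx ⟨_, h, stereographic_symm_apply hxq⟩,
      stereographic_symm_apply hxq]

lemma contMDiff_glue (hf : IsImmersionS2 f) (hΦ1 : ContDiff ℝ 1 Φ) (hK : IsCompact K)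
    (hΦ : ∀ t, ∀ y ∉ K, Φ (t, y) = f ((stereographic' 2 q : OpenPartialHomeomorph S2 E2).symm y)) :
    ContMDiff (𝓘(ℝ, ℝ).prod (𝓡 2)) 𝓘(ℝ, E3) 1 (glue q f Φ) := by
  rintro ⟨t, x⟩
  by_cases hx : x = q
  · subst hx
    refine (hf.1.comp contMDiff_snd (t, x)).congr_of_eventuallyEq ?_
    filter_upwards [continuous_snd.continuousAt.eventually (eventually_glue_eq hK hΦ)] with z hz
    exact hz z.1
  · have h : ContMDiffAt (𝓘(ℝ, ℝ).prod (𝓡 2)) 𝓘(ℝ, ℝ × E2) 1 (fun z : ℝ × S2 =>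
        (z.1, (stereographic' 2 q : OpenPartialHomeomorph S2 E2) z.2)) (t, x) :=
      contMDiffAt_fst.prodMk_space ((contMDiffAt_stereographic hx).comp (t, x) contMDiffAt_snd)
    refine ((hΦ1.contMDiff.contMDiffAt).comp (t, x) h).congr_of_eventuallyEq ?_
    filter_upwards [continuous_snd.continuousAt.eventually (isOpen_ne.mem_nhds hx)] with z hz
    exact glue_of_ne hz z.1

lemma injective_mfderiv_glue (hf : IsImmersionS2 f) (hΦ1 : ContDiff ℝ 1 Φ) (hK : IsCompact K)
    (hΦ : ∀ t, ∀ y ∉ K, Φ (t, y) = f ((stereographic' 2 q : OpenPartialHomeomorph S2 E2).symm y))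
    (hi : ∀ t y, Injective (fderiv ℝ (fun y => Φ (t, y)) y)) (t : ℝ) (x : S2) :
    Injective (mfderiv (𝓡 2) 𝓘(ℝ, E3) (fun x => glue q f Φ (t, x)) x) := by
  by_cases hx : x = q
  · subst hx
    have h : (fun z => glue x f Φ (t, z)) =ᶠ[𝓝 x] f := by
      filter_upwards [eventually_glue_eq hK hΦ] with z hz using hz t
    have := hf.2 x
    have e := h.mfderiv_eq (I := 𝓡 2) (I' := 𝓘(ℝ, E3))
    rwa [← e] at this
  · apply injective_mfderiv_of_stereographic hx
    · simp_rw [glue_symm]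
      exact hi _ _
    · simp_rw [glue_symm]
      exact (hΦ1.differentiable one_ne_zero).comp
        ((differentiable_const t).prodMk differentiable_id) _

end Glue

lemma isImmersionS2_stdEmb : IsImmersionS2 stdEmb :=
  ⟨contMDiff_coe_sphere, fun x => by convert! injective_mvfderiv_subtypeVal_sphere x⟩

/-- Near a point, an immersion may be deformed to any map with the same first-order jet at that
point, through immersions, keeping it fixed outside a small ball. -/
lemma exists_homotopy_add_near {E F : Type*} [NormedAddCommGroup E] [InnerProductSpace ℝ E]
    [FiniteDimensional ℝ E] [NormedAddCommGroup F] [NormedSpace ℝ F] {h g : E → F}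
    (hh : ContDiff ℝ 1 h) (hg : ContDiff ℝ 1 g) (hi : ∀ y, Injective (fderiv ℝ h y)) {y₀ : E}
    (hg0 : g y₀ = 0) (hg1 : fderiv ℝ g y₀ = 0) :
    ∃ (Φ : ℝ × E → F) (K : Set E), IsCompact K ∧ ContDiff ℝ 1 Φ ∧
      (∀ t, ∀ y ∉ K, Φ (t, y) = h y) ∧ (∀ y, Φ (0, y) = h y) ∧
      (∀ᶠ y in 𝓝 y₀, Φ (1, y) = h y + g y) ∧
      (∀ t y, Injective (fderiv ℝ (fun y => Φ (t, y)) y)) ∧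
      (∀ t, Φ (t, y₀) = h y₀) ∧ ∀ t, fderiv ℝ (fun y => Φ (t, y)) y₀ = fderiv ℝ h y₀ := by
  obtain ⟨δ, hδ, hδi⟩ := Metric.isOpen_iff.1
    (ContinuousLinearMap.isOpen_injective (𝕜 := ℝ) (E := E) (F := F)) _ (hi y₀)
  let χ : ContDiffBump (0 : E) := ⟨1, 2, one_pos, one_lt_two⟩
  have hχ : ContDiff ℝ 1 χ := χ.contDiff
  obtain ⟨C, hC⟩ := (hχ.continuous_fderiv one_ne_zero).bounded_above_of_compact_support
    (χ.hasCompactSupport.fderiv (𝕜 := ℝ))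
  have hC0 : 0 ≤ C := (norm_nonneg _).trans (hC 0)
  obtain ⟨η, hη, hηδ⟩ : ∃ η > 0, η * (1 + 2 * C) < δ / 2 := by
    refine ⟨δ / 4 / (1 + 2 * C), by positivity, ?_⟩
    rw [div_mul_cancel₀ _ (by positivity)]
    linarith
  have e1 : ∀ᶠ y in 𝓝 y₀, dist (fderiv ℝ h y) (fderiv ℝ h y₀) < δ / 2 :=
    (hh.continuous_fderiv one_ne_zero).continuousAt.eventually
      (Metric.ball_mem_nhds _ (half_pos hδ))
  have e2 : ∀ᶠ y in 𝓝 y₀, dist (fderiv ℝ g y) (fderiv ℝ g y₀) < η :=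
    (hg.continuous_fderiv one_ne_zero).continuousAt.eventually (Metric.ball_mem_nhds _ hη)
  obtain ⟨r, hr, hrb⟩ := Metric.eventually_nhds_iff_ball.1 (e1.and e2)
  simp only [hg1, dist_zero_right] at hrb
  have hgd : Differentiable ℝ g := hg.differentiable one_ne_zero
  have hhd : Differentiable ℝ h := hh.differentiable one_ne_zero
  have hgb : ∀ y ∈ ball y₀ r, ‖g y‖ ≤ η * ‖y - y₀‖ := by
    intro y hy
    have := (convex_ball y₀ r).norm_image_sub_le_of_norm_fderiv_le (𝕜 := ℝ)
      (fun z _ => hgd z) (fun z hz => (hrb z hz).2.le) (mem_ball_self hr) hy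
    simpa [hg0] using this
  set ε : ℝ := r / 4 with hε
  have hε0 : 0 < ε := by positivity
  let ψ : E → ℝ := fun y => χ (ε⁻¹ • (y - y₀))
  have hψ : ContDiff ℝ 1 ψ :=
    hχ.comp (contDiff_const.smul (contDiff_id.sub contDiff_const))
  have hψd : ∀ y, HasFDerivAt ψ (ε⁻¹ • fderiv ℝ χ (ε⁻¹ • (y - y₀))) y := by
    intro y
    have a : HasFDerivAt (fun y : E => ε⁻¹ • (y - y₀)) (ε⁻¹ • ContinuousLinearMap.id ℝ E) y :=
      ((hasFDerivAt_id y).sub_const y₀).const_smul ε⁻¹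
    have b := ((hχ.differentiable one_ne_zero) (ε⁻¹ • (y - y₀))).hasFDerivAt.comp y a
    rwa [ContinuousLinearMap.comp_smul, ContinuousLinearMap.comp_id] at b
  have hψout : ∀ y ∉ closedBall y₀ (2 * ε), ψ y = 0 := by
    intro y hy
    refine χ.zero_of_le_dist ?_
    rw [mem_closedBall, not_le, dist_eq_norm] at hy
    rw [dist_zero_right, norm_smul, norm_inv, Real.norm_of_nonneg hε0.le]
    change 2 ≤ _
    rw [inv_mul_eq_div, le_div_iff₀ hε0]
    exact hy.le
  have hψin : ∀ᶠ y in 𝓝 y₀, ψ y = 1 := by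
    filter_upwards [Metric.closedBall_mem_nhds y₀ hε0] with y hy
    refine χ.one_of_mem_closedBall ?_
    rw [mem_closedBall, dist_eq_norm] at hy
    rw [mem_closedBall, dist_zero_right, norm_smul, norm_inv, Real.norm_of_nonneg hε0.le]
    change _ ≤ (1 : ℝ)
    rw [inv_mul_eq_div, div_le_one hε0]
    exact hy
  let Φ : ℝ × E → F := fun z => h z.2 + Real.smoothTransition z.1 • ψ z.2 • g z.2
  have hΦd : ∀ t y, HasFDerivAt (fun y => Φ (t, y)) (fderiv ℝ h y + Real.smoothTransition t •
      (ψ y • fderiv ℝ g y + (ε⁻¹ • fderiv ℝ χ (ε⁻¹ • (y - y₀))).smulRight (g y))) y := by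
    intro t y
    exact (hhd y).hasFDerivAt.add
      (((hψd y).smul (hgd y).hasFDerivAt).const_smul (Real.smoothTransition t))
  refine ⟨Φ, closedBall y₀ (2 * ε), isCompact_closedBall _ _, ?_, ?_, ?_, ?_, ?_, ?_, ?_⟩
  · exact (hh.comp contDiff_snd).add ((Real.smoothTransition.contDiff.comp contDiff_fst).smul
      ((hψ.comp contDiff_snd).smul (hg.comp contDiff_snd)))
  · intro t y hy
    simp [Φ, hψout y hy]
  · intro y
    simp [Φ]
  · filter_upwards [hψin] with y hy
    simp [Φ, hy]
  · intro t y
    by_cases hy : y ∈ closedBall y₀ (2 * ε)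
    · have hyr : y ∈ ball y₀ r := by
        rw [mem_closedBall] at hy
        rw [mem_ball]
        linarith
      rw [(hΦd t y).fderiv]
      apply hδi
      rw [mem_ball]
      have k1 : ‖ψ y • fderiv ℝ g y‖ ≤ η := by
        rw [norm_smul, Real.norm_of_nonneg χ.nonneg]
        exact (mul_le_of_le_one_left (norm_nonneg _) χ.le_one).trans (hrb y hyr).2.le
      have k2 : ‖(ε⁻¹ • fderiv ℝ χ (ε⁻¹ • (y - y₀))).smulRight (g y)‖ ≤ η * (2 * C) := by
        rw [ContinuousLinearMap.norm_smulRight_apply, norm_smul, norm_inv,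
          Real.norm_of_nonneg hε0.le]
        have a := hC (ε⁻¹ • (y - y₀))
        have b : ‖g y‖ ≤ η * (2 * ε) := by
          refine (hgb y hyr).trans ?_
          rw [mem_closedBall, dist_eq_norm] at hy
          gcongr
        calc ε⁻¹ * ‖fderiv ℝ χ (ε⁻¹ • (y - y₀))‖ * ‖g y‖ ≤ ε⁻¹ * C * (η * (2 * ε)) := by
              gcongr
          _ = η * (2 * C) := by field_simp
      have k3 : ‖Real.smoothTransition t • (ψ y • fderiv ℝ g y +
          (ε⁻¹ • fderiv ℝ χ (ε⁻¹ • (y - y₀))).smulRight (g y))‖ ≤ η + η * (2 * C) := by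
        rw [norm_smul, Real.norm_of_nonneg (Real.smoothTransition.nonneg t)]
        exact (mul_le_of_le_one_left (norm_nonneg _) (Real.smoothTransition.le_one t)).trans
          ((norm_add_le _ _).trans (add_le_add k1 k2))
      have k4 := (hrb y hyr).1
      rw [dist_eq_norm] at k4 ⊢
      rw [add_sub_right_comm]
      refine (norm_add_le _ _).trans_lt ?_
      linarith
    · have : (fun y => Φ (t, y)) =ᶠ[𝓝 y] h := by
        filter_upwards [Metric.isClosed_closedBall.isOpen_compl.mem_nhds hy] with z hz
        simp [Φ, hψout z hz]
      rw [this.fderiv_eq]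
      exact hi y
  · intro t
    simp [Φ, hg0]
  · intro t
    rw [(hΦd t y₀).fderiv]
    simp [hg0, hg1]

/-- A pointed immersion is homotopic to one which is standard near the base point. -/
lemma PointedImm.exists_joined_eventuallyEq {p : S2} (f : PointedImm p) :
    ∃ f' : PointedImm p, Joined f f' ∧ f'.1 =ᶠ[𝓝 p] stdEmb := by
  obtain ⟨f, hf, hfp, hfD⟩ := f
  set q : S2 := -p with hq
  have hpq : p ≠ q := by
    intro h
    have h2 : (p : E3) = -(p : E3) := congrArg Subtype.val h
    have h3 : ‖(p : E3)‖ = 1 := by simp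
    have h4 : (p : E3) = 0 := by
      have : (2 : ℝ) • (p : E3) = 0 := by
        rw [two_smul]
        exact eq_neg_iff_add_eq_zero.1 h2
      simpa using this
    rw [h4] at h3
    simp at h3
  set σ := (stereographic' 2 q : OpenPartialHomeomorph S2 E2).symm with hσ
  set y₀ : E2 := stereographic' 2 q p with hy₀
  have hσ0 : σ y₀ = p := stereographic_symm_apply hpq
  have c1 := hf.contDiff_comp_symm q
  have c0 := isImmersionS2_stdEmb.contDiff_comp_symm q
  have d1 := c1.differentiable one_ne_zero
  have d0 := c0.differentiable one_ne_zero
  have hinj : ∀ y, Injective (fderiv ℝ (fun y => f (σ y)) y) := fun y =>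
    injective_fderiv_comp_symm ((hf.1 _).mdifferentiableAt one_ne_zero) (hf.2 _)
  have hsurj := (mdifferentiable_stereographic q).mfderiv_surjective (x := p) (by simpa using hpq)
  have hfd : fderiv ℝ (fun y => f (σ y)) y₀ = fderiv ℝ (fun y => stdEmb (σ y)) y₀ := by
    have a1 := mfderiv_eq_comp_stereographic hpq (d1 y₀)
    have a0 := mfderiv_eq_comp_stereographic hpq (d0 y₀)
    have a := a1.symm.trans (hfD.trans a0)
    ext1 v
    obtain ⟨w, rfl⟩ := hsurj v
    exact DFunLike.congr_fun a w
  have hg1 : fderiv ℝ (fun y => stdEmb (σ y) - f (σ y)) y₀ = 0 := by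
    rw [fderiv_fun_sub (d0 y₀) (d1 y₀), hfd, sub_self]
  have hg0 : stdEmb (σ y₀) - f (σ y₀) = 0 := by rw [hσ0, hfp, sub_self]
  obtain ⟨Φ, K, hK, hΦ, hΦK, hΦ0, hΦ1, hΦi, hΦy, hΦd⟩ :=
    exists_homotopy_add_near c1 (c0.sub c1) hinj hg0 hg1
  have hF := contMDiff_glue hf hΦ hK hΦK
  have hFi := injective_mfderiv_glue hf hΦ hK hΦK hΦi
  have hFp : ∀ t, glue q f Φ (t, p) = stdEmb p := by
    intro t
    rw [glue_of_ne hpq, ← hy₀, hΦy, ← hfp]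
    exact congrArg f hσ0
  have hFd : ∀ t, mfderiv (𝓡 2) 𝓘(ℝ, E3) (fun x => glue q f Φ (t, x)) p =
      mfderiv (𝓡 2) 𝓘(ℝ, E3) stdEmb p := by
    intro t
    have e : (fun y => glue q f Φ (t, (stereographic' 2 q : OpenPartialHomeomorph S2 E2).symm y))
        = fun y => Φ (t, y) := funext fun y => glue_symm t y
    have dt : Differentiable ℝ fun y => Φ (t, y) := (hΦ.differentiable one_ne_zero).comp
        ((differentiable_const t).prodMk differentiable_id)
    have a := mfderiv_eq_comp_stereographic (f := fun x => glue q f Φ (t, x)) hpq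
      (by rw [e]; exact dt _)
    have a1 := mfderiv_eq_comp_stereographic hpq (d1 y₀)
    have b : fderiv ℝ (fun y => glue q f Φ
        (t, (stereographic' 2 q : OpenPartialHomeomorph S2 E2).symm y)) y₀ =
        fderiv ℝ (fun y => f (σ y)) y₀ := by
      rw [e, hΦd]
    refine ContinuousLinearMap.ext fun w => ?_
    have u := DFunLike.congr_fun a w
    have v := DFunLike.congr_fun (a1.symm.trans hfD) w
    refine u.trans (Eq.trans ?_ v)
    exact DFunLike.congr_fun b _
  let f' : PointedImm p := ⟨fun x => glue q f Φ (1, x), ⟨contMDiff_slice hF 1, hFi 1⟩, hFp 1, hFd 1⟩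
  refine ⟨f', PointedImm.joined_of_contMDiff hF hFi hFp hFd (fun x => ?_) (fun x => rfl), ?_⟩
  · by_cases hx : x = q
    · simp [glue, hx]
    · rw [glue_of_ne hx, hΦ0, stereographic_symm_apply hx]
  · have hc := (contMDiffAt_stereographic hpq).continuousAt
    filter_upwards [hc.eventually hΦ1, isOpen_ne.mem_nhds hpq] with x hx hxq
    change glue q f Φ (1, x) = _
    rw [glue_of_ne hxq, hx, stereographic_symm_apply hxq]
    abel

lemma injective_iff_crossProduct_ne_zero (A : ℝ × ℝ →L[ℝ] Fin 3 → ℝ) :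
    Injective A ↔ A (1, 0) ⨯₃ A (0, 1) ≠ 0 := by
  have h : ∀ s t : ℝ, A (s, t) = s • A (1, 0) + t • A (0, 1) := by
    intro s t
    rw [← map_smul, ← map_smul, ← map_add]
    simp
  rw [crossProduct_ne_zero_iff_linearIndependent, LinearIndependent.pair_iff,
    injective_iff_map_eq_zero]
  constructor
  · intro hA s t hst
    have := hA (s, t) ((h s t).trans hst)
    simpa using this
  · rintro hA ⟨s, t⟩ hst
    have := hA s t ((h s t).symm.trans hst)
    simp [this.1, this.2]

lemma planeImmersion_iff {g : ℝ × ℝ → Fin 3 → ℝ} :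
    PlaneImmersion g ↔ ContDiff ℝ 1 g ∧ ∀ x, Injective (fderiv ℝ g x) := by
  simp only [injective_iff_crossProduct_ne_zero]
  exact ⟨fun h => ⟨h.contDiff, h.cross_ne_zero⟩, fun h => ⟨h.1, h.2⟩⟩

lemma injective_fderiv_conj {E E' F F' : Type*} [NormedAddCommGroup E] [NormedSpace ℝ E]
    [NormedAddCommGroup E'] [NormedSpace ℝ E'] [NormedAddCommGroup F] [NormedSpace ℝ F]
    [NormedAddCommGroup F'] [NormedSpace ℝ F'] (L : E' ≃L[ℝ] E) (T : F ≃L[ℝ] F') {g : E → F}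
    (hg : Differentiable ℝ g) (hi : ∀ y, Injective (fderiv ℝ g y)) (x : E') :
    Injective (fderiv ℝ (fun x => T (g (L x))) x) := by
  have h : HasFDerivAt (fun x => T (g (L x))) _ x :=
    T.hasFDerivAt.comp x ((hg (L x)).hasFDerivAt.comp x L.hasFDerivAt)
  rw [h.fderiv]
  exact T.injective.comp ((hi _).comp L.injective)

/-- Two immersions of the Euclidean plane in space which agree off a compact set are homotopic
through immersions, relative to the complement of a compact set. -/
lemma exists_homotopy_of_eq_off_compact {h₀ h₁ : E2 → E3} (c₀ : ContDiff ℝ 1 h₀)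
    (c₁ : ContDiff ℝ 1 h₁) (i₀ : ∀ y, Injective (fderiv ℝ h₀ y))
    (i₁ : ∀ y, Injective (fderiv ℝ h₁ y)) {K : Set E2} (hK : IsCompact K)
    (hh : ∀ y ∉ K, h₀ y = h₁ y) :
    ∃ (Φ : ℝ × E2 → E3) (K' : Set E2), IsCompact K' ∧ ContDiff ℝ 1 Φ ∧
      (∀ t, ∀ y ∉ K', Φ (t, y) = h₀ y) ∧ (∀ y, Φ (0, y) = h₀ y) ∧ (∀ y, Φ (1, y) = h₁ y) ∧
      ∀ t y, Injective (fderiv ℝ (fun y => Φ (t, y)) y) := by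
  let L : (ℝ × ℝ) ≃L[ℝ] E2 :=
    (ContinuousLinearEquiv.finTwoArrow ℝ ℝ).symm.trans (EuclideanSpace.equiv (Fin 2) ℝ).symm
  let T : E3 ≃L[ℝ] (Fin 3 → ℝ) := EuclideanSpace.equiv (Fin 3) ℝ
  have p₀ : PlaneImmersion fun x => T (h₀ (L x)) := planeImmersion_iff.2
    ⟨T.contDiff.comp (c₀.comp L.contDiff),
      injective_fderiv_conj L T (c₀.differentiable one_ne_zero) i₀⟩
  have p₁ : PlaneImmersion fun x => T (h₁ (L x)) := planeImmersion_iff.2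
    ⟨T.contDiff.comp (c₁.comp L.contDiff),
      injective_fderiv_conj L T (c₁.differentiable one_ne_zero) i₁⟩
  have hLK : ∀ x ∉ L.symm '' K, T (h₀ (L x)) = T (h₁ (L x)) := by
    intro x hx
    rw [hh (L x) fun h => hx ⟨_, h, by simp⟩]
  obtain ⟨R, G, hG, hG0, hG1, hGR, hGi⟩ :=
    exists_regularHomotopy_of_eq_off_ball p₀ p₁ (hK.image L.symm.continuous) hLK
  refine ⟨fun z => T.symm (G (3 * z.1 - 1, L.symm z.2)), L '' closedBall 0 R,
    (isCompact_closedBall 0 R).image L.continuous, ?_, ?_, ?_, ?_, ?_⟩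
  · exact T.symm.contDiff.comp (hG.comp (((contDiff_const.mul contDiff_fst).sub
      contDiff_const).prodMk (L.symm.contDiff.comp contDiff_snd)))
  · intro t y hy
    have : R < ‖L.symm y‖ := by
      by_contra h
      exact hy ⟨L.symm y, by simpa using h, by simp⟩
    simp [hGR _ _ this]
  · intro y
    have := hG0 (L.symm y)
    simp [this]
  · intro y
    have := hG1 (L.symm y)
    norm_num [this]
  · intro t y
    obtain ⟨c, i⟩ := planeImmersion_iff.1 (hGi (3 * t - 1))
    exact injective_fderiv_conj L.symm T.symm (c.differentiable one_ne_zero) i y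

/-- The standard embedding as a pointed immersion. -/
def PointedImm.std (p : S2) : PointedImm p := ⟨stdEmb, isImmersionS2_stdEmb, rfl, rfl⟩

lemma PointedImm.joined_std_of_eventuallyEq {p : S2} (f : PointedImm p)
    (h : f.1 =ᶠ[𝓝 p] stdEmb) : Joined f (PointedImm.std p) := by
  obtain ⟨f, hf, hfp, hfD⟩ := f
  change f =ᶠ[𝓝 p] stdEmb at h
  obtain ⟨U, hUe, hU, hpU⟩ := _root_.mem_nhds_iff.1 h
  set σ := (stereographic' 2 p : OpenPartialHomeomorph S2 E2).symm with hσ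
  have hK : IsCompact (stereographic' 2 p '' Uᶜ) := by
    refine hU.isClosed_compl.isCompact.image_of_continuousOn fun x hx => ?_
    have hxp : x ≠ p := fun e => hx (e ▸ hpU)
    exact (contMDiffAt_stereographic hxp).continuousAt.continuousWithinAt
  have hσK : ∀ y ∉ stereographic' 2 p '' Uᶜ, f (σ y) = stdEmb (σ y) := by
    intro y hy
    refine hUe ?_
    by_contra hn
    exact hy ⟨σ y, hn, stereographic_apply_symm p y⟩
  have hinj : ∀ {u : S2 → E3}, IsImmersionS2 u → ∀ y, Injective (fderiv ℝ (fun y => u (σ y)) y) :=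
    fun hu y => injective_fderiv_comp_symm ((hu.1 _).mdifferentiableAt one_ne_zero) (hu.2 _)
  obtain ⟨Φ, K', hK', hΦ, hΦK, hΦ0, hΦ1, hΦi⟩ := exists_homotopy_of_eq_off_compact
    (hf.contDiff_comp_symm p) (isImmersionS2_stdEmb.contDiff_comp_symm p) (hinj hf)
    (hinj isImmersionS2_stdEmb) hK hσK
  have hnear : ∀ t, (fun x => glue p f Φ (t, x)) =ᶠ[𝓝 p] f := fun t => by
    filter_upwards [eventually_glue_eq hK' hΦK] with x hx using hx t
  refine PointedImm.joined_of_contMDiff (contMDiff_glue hf hΦ hK' hΦK)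
    (injective_mfderiv_glue hf hΦ hK' hΦK hΦi) (fun t => ?_) (fun t => ?_) (fun x => ?_)
    (fun x => ?_)
  · exact (hnear t).eq_of_nhds.trans hfp
  · exact (hnear t).mfderiv_eq.trans hfD
  · by_cases hx : x = p
    · simp [glue, hx]
    · rw [glue_of_ne hx, hΦ0, stereographic_symm_apply hx]
  · by_cases hx : x = p
    · rw [hx]
      exact (hnear 1).eq_of_nhds.trans hfp
    · rw [glue_of_ne hx, hΦ1, stereographic_symm_apply hx]
      rfl

end Auxiliary

/-- `π₀(Imm_p(S², ℝ³)) = 0`: the space of pointed immersions of `S²` into `ℝ³`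
(with the `C¹` topology) is path-connected. -/
theorem pointedImmersions_pathConnected (p : S2) :
    PathConnectedSpace (PointedImm p) := by
  have h : ∀ f : PointedImm p, Joined f (PointedImm.std p) := fun f => by
    obtain ⟨f', hff', hf'⟩ := f.exists_joined_eventuallyEq
    exact hff'.trans (f'.joined_std_of_eventuallyEq hf')
  exact ⟨⟨PointedImm.std p⟩, fun f g => (h f).trans (h g).symm⟩

end
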